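/- (Burgess inequality) For every integer r ≥ 2 there exists a constant C(r) > 0 such that for every prime p, every nonprincipal Dirichlet character χ modulo p, and every real x ≥ 2, one has | ∑_{m ≤ x} χ(m) | ≤ C(r) · x^{1−1/r} · p^{(r+1)/(4r²)} · (log p)^{1/(2r)}. -/

import Mathlib

open Polynomial in
theorem eq_zero_of_sum_C_mul_X_pow_mul_eq_zero {ι K : Type*} [Field K] [Fintype ι]
    {e : ι → ℕ} (he : Function.Injective e) {g : ι → K[X]} (hg : ∀ i, (g i).coeff 0 ≠ 0)
    {w : ι → K} (h : ∑ i, C (w i) * (X ^ e i * g i) = 0) : w = 0 := by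
  classical
  by_contra hw
  obtain ⟨i₀, hi₀⟩ := Function.ne_iff.mp hw
  obtain ⟨i, hi, hmin⟩ := Finset.exists_min_image (Finset.univ.filter fun i => w i ≠ 0) e
    ⟨i₀, by simpa using hi₀⟩
  simp only [Finset.mem_filter, Finset.mem_univ, true_and] at hi hmin
  have hc := congrArg (fun q => q.coeff (e i)) h
  simp only [finsetSum_coeff, coeff_C_mul, coeff_X_pow_mul', coeff_zero] at hc
  rw [Finset.sum_eq_single i] at hc
  · simp [hi, hg] at hc
  · intro j _ hj
    by_cases hwj : w j = 0
    · simp [hwj]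
    · have : e i < e j := lt_of_le_of_ne (hmin j hwj) fun h => hj (he h).symm
      rw [if_neg (by omega), mul_zero]
  · simp

open Polynomial in
/-- A nontrivial linear relation between more polynomials than the dimension of the space in
which they live. -/
theorem exists_nontrivial_sum_C_mul_eq_zero {ι K : Type*} [Field K] [Fintype ι] {n : ℕ}
    (E : ι → K[X]) (hE : ∀ i, (E i).natDegree < n) (hn : n < Fintype.card ι) :
    ∃ U : ι → K, U ≠ 0 ∧ ∑ i, C (U i) * E i = 0 := by
  let Φ : (ι → K) →ₗ[K] (Fin n → K) :=
    { toFun := fun U t => ∑ i, U i * (E i).coeff t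
      map_add' := fun U V => by ext t; simp [add_mul, Finset.sum_add_distrib]
      map_smul' := fun c U => by ext t; simp [Finset.mul_sum, mul_assoc] }
  have hker : LinearMap.ker Φ ≠ ⊥ :=
    LinearMap.ker_ne_bot_of_finrank_lt (by simpa using hn)
  obtain ⟨U, hU, hU0⟩ := Submodule.exists_mem_ne_zero_of_ne_bot hker
  refine ⟨U, hU0, ?_⟩
  ext t
  simp only [finsetSum_coeff, coeff_C_mul, coeff_zero]
  by_cases ht : t < n
  · exact congrFun (LinearMap.mem_ker.mp hU) ⟨t, ht⟩
  · refine Finset.sum_eq_zero fun i _ => ?_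
    rw [coeff_eq_zero_of_natDegree_lt ((hE i).trans_le (not_lt.mp ht)), mul_zero]

open Polynomial in
/-- Stepanov's method in the form of Bombieri: over a field with `s ^ 2` elements, a power
`f ^ ((s ^ 2 - 1) / d)` of a polynomial with a simple zero at the origin takes each nonzero value
at most `s ^ 2 / d + O(s)` times. -/
theorem card_eval_pow_eq_le {p k : ℕ} [Fact p.Prime] {K : Type*} [Field K] [Fintype K]
    [DecidableEq K] [CharP K p] {s : ℕ} (hsp : s = p ^ k) (hcard : Fintype.card K = s ^ 2)
    (hs : 3 ≤ s) {d σ : ℕ} (hd : d * σ + 1 = s) {g : K[X]} (hg : g.coeff 0 ≠ 0) {D : ℕ}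
    (hD : (X * g).natDegree ≤ D) {a : K} (ha : a ≠ 0) :
    d * (Finset.univ.filter fun x : K => (X * g).eval x ^ (σ * (s + 1)) = a).card
      ≤ s ^ 2 + d * (4 * D + 6) * s := by
  set f := X * g with hf
  have hfd : ∀ n, (f ^ n).natDegree ≤ n * D := fun n =>
    natDegree_pow_le.trans (Nat.mul_le_mul_left _ hD)
  have hdpos : 0 < d := by
    rcases Nat.eq_zero_or_pos d with h | h
    · simp [h] at hd; omega
    · exact h
  have hσpos : 0 < σ := by
    rcases Nat.eq_zero_or_pos σ with h | h
    · simp [h] at hd; omega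
    · exact h
  set J := σ + 3 * D + 5 with hJ
  let ι := Fin d × Fin J × Fin σ
  let E : ι → K[X] := fun i =>
    C (a ^ (i.1 : ℕ)) * (X ^ (s * i.2.2 + i.2.1) * f ^ (σ * (d - 1 - i.1)))
  have hEdeg : ∀ i, (E i).natDegree < σ * s + J + s * D := by
    rintro ⟨i, j, l⟩
    have h1 : (E (i, j, l)).natDegree ≤ (s * l + j) + σ * (d - 1 - i) * D := by
      refine (natDegree_C_mul_le _ _).trans (natDegree_mul_le.trans ?_)
      rw [natDegree_X_pow]
      exact Nat.add_le_add_left (hfd _) _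
    have h2 : s * (l : ℕ) ≤ s * σ := Nat.mul_le_mul_left _ l.2.le
    have h3 : σ * (d - 1 - i) * D ≤ s * D := by
      apply Nat.mul_le_mul_right
      calc σ * (d - 1 - i) ≤ σ * d := Nat.mul_le_mul_left _ (by omega)
        _ ≤ s := by rw [mul_comm]; omega
    have := j.2
    rw [mul_comm σ s]
    omega
  have hι : σ * s + J + s * D < Fintype.card ι := by
    have hc : Fintype.card ι = d * (J * σ) := by simp [ι]
    rw [hc]
    have h1 : d * (J * σ) + J = s * J := by rw [← hd]; ring
    have h2 : σ ≤ s - 1 := by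
      have : 1 * σ ≤ d * σ := Nat.mul_le_mul_right _ hdpos
      omega
    obtain ⟨u, rfl⟩ : ∃ u, s = u + 3 := ⟨s - 3, by omega⟩
    have h3 : σ ≤ u + 2 := by omega
    nlinarith [Nat.zero_le (u * D), Nat.zero_le (u*σ)]
  obtain ⟨U, hU0, hU⟩ := exists_nontrivial_sum_C_mul_eq_zero E hEdeg hι
  let R : K[X] := ∑ i : ι, C (U i ^ s) * (X ^ (i.2.2 + i.2.1 * s : ℕ) * f ^ (σ * i.1))
  have hR0 : R ≠ 0 := by
    intro hR
    have hinj : Function.Injective fun i : ι => (i.2.2 + i.2.1 * s + σ * i.1 : ℕ) := by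
      rintro ⟨i, j, l⟩ ⟨i', j', l'⟩ h
      simp only at h
      have key : ∀ (i : Fin d) (l : Fin σ), (l : ℕ) + σ * i < s := fun i l => by
        have h1 : σ * i + σ ≤ σ * d := by
          rw [← Nat.mul_succ]; exact Nat.mul_le_mul_left _ i.2
        have := l.2
        rw [mul_comm σ d] at h1
        omega
      have e1 : (l : ℕ) + σ * i + s * j = l' + σ * i' + s * j' := by linarith
      have hs0 : 0 < s := by omega
      have e2 := congrArg (· % s) e1
      have e3 := congrArg (· / s) e1
      simp only [Nat.add_mul_mod_self_left, Nat.mod_eq_of_lt (key i l),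
        Nat.mod_eq_of_lt (key i' l')] at e2
      simp only [Nat.add_mul_div_left _ _ hs0, Nat.div_eq_of_lt (key i l),
        Nat.div_eq_of_lt (key i' l'), zero_add] at e3
      have e4 := congrArg (· % σ) e2
      have e5 := congrArg (· / σ) e2
      simp only [Nat.add_mul_mod_self_left, Nat.mod_eq_of_lt l.2, Nat.mod_eq_of_lt l'.2] at e4
      simp only [Nat.add_mul_div_left _ _ hσpos, Nat.div_eq_of_lt l.2, Nat.div_eq_of_lt l'.2,
        zero_add] at e5
      ext <;> simp [*]
    have := eq_zero_of_sum_C_mul_X_pow_mul_eq_zero (w := fun i => U i ^ s)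
      (g := fun i : ι => g ^ (σ * i.1)) hinj
      (fun i => by rw [coeff_zero_eq_eval_zero] at hg ⊢; simp [hg]) (by
        rw [← hR]
        refine Finset.sum_congr rfl fun i _ => ?_
        simp only [hf, mul_pow, pow_add]
        ring)
    apply hU0
    ext i
    exact pow_eq_zero_iff (by omega) |>.mp (congrFun this i)
  have hroot : ∀ x, f.eval x ^ (σ * (s + 1)) = a → R.eval x = 0 := by
    intro x hx
    set z := f.eval x ^ σ with hz
    have hzs : z ^ (s + 1) = a := by rw [hz, ← pow_mul, hx]
    have hz0 : z ≠ 0 := by rintro h; rw [h] at hzs; simp at hzs; exact ha hzs.symm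
    have hfrob : ∀ y : K, y ^ (s * s) = y := fun y => by
      rw [← sq, ← hcard, FiniteField.pow_card]
    have h0 := congrArg (eval x) hU
    have hRs : R.eval x ^ s * z ^ (d - 1) = 0 := by
      rw [eval_zero] at h0
      rw [← h0, eval_finsetSum, eval_finsetSum, hsp, sum_pow_char_pow, ← hsp, Finset.sum_mul]
      refine Finset.sum_congr rfl fun i _ => ?_
      have hi : (i.1 : ℕ) < d := i.1.2
      obtain ⟨t, ht⟩ : ∃ t, d - 1 = i.1 + t := ⟨d - 1 - i.1, by omega⟩
      simp only [E, eval_mul, eval_C, eval_pow, eval_X, mul_pow]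
      rw [ht, Nat.add_sub_cancel_left, pow_mul _ σ t, pow_mul _ σ (i.1 : ℕ), ← hz, ← hzs,
        ← pow_mul (U i), hfrob]
      have : (x ^ (i.2.2 + i.2.1 * s : ℕ)) ^ s = x ^ (s * i.2.2 + i.2.1 : ℕ) := by
        rw [pow_add, mul_pow, ← pow_mul, ← pow_mul, mul_assoc, mul_comm _ (s * s), pow_mul _ (s*s),
          hfrob, pow_add, mul_comm s]
      rw [this]
      ring
    rcases mul_eq_zero.mp hRs with h | h
    · exact pow_eq_zero_iff (by omega) |>.mp h
    · exact absurd h (pow_ne_zero _ hz0)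
  have hcount : (Finset.univ.filter fun x : K => f.eval x ^ (σ * (s + 1)) = a).card
      ≤ R.natDegree := by
    classical
    refine le_trans (Finset.card_le_card (t := R.roots.toFinset) fun x hx => ?_)
      ((Multiset.toFinset_card_le _).trans (card_roots' R))
    simp only [Finset.mem_filter, Finset.mem_univ, true_and] at hx
    simpa [hR0] using hroot x hx
  have hRdeg : R.natDegree ≤ σ + J * s + s * D := by
    refine natDegree_sum_le_of_forall_le _ _ ?_
    rintro ⟨i, j, l⟩ _
    refine (natDegree_C_mul_le _ _).trans (natDegree_mul_le.trans ?_)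
    rw [natDegree_X_pow]
    have h2 : (j : ℕ) * s ≤ J * s := Nat.mul_le_mul_right _ j.2.le
    have h3 : σ * i * D ≤ s * D := by
      apply Nat.mul_le_mul_right
      calc σ * (i : ℕ) ≤ σ * d := Nat.mul_le_mul_left _ i.2.le
        _ ≤ s := by rw [mul_comm]; omega
    have h4 := hfd (σ * i)
    have := l.2
    simp only
    omega
  have hfin : d * (σ + J * s + s * D) ≤ s ^ 2 + d * (4 * D + 6) * s := by
    have h1 : d * (σ + J * s + s * D) = d * σ + (d * σ) * s + d * (4 * D + 5) * s := by
      rw [hJ]; ring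
    have h2 : d * (4 * D + 6) * s = d * (4 * D + 5) * s + d * s := by ring
    have h3 : d * σ * s + s = s ^ 2 := by rw [sq]; nth_rewrite 3 [← hd]; ring
    have h4 : 1 * s ≤ d * s := Nat.mul_le_mul_right _ hdpos
    omega
  exact (Nat.mul_le_mul_left _ (hcount.trans hRdeg)).trans hfin

/-- If no nonzero residue is hit much more often than average, then a nonprincipal character
cancels. -/
theorem norm_sum_mulChar_comp_le {p : ℕ} [Fact p.Prime] {χ : MulChar (ZMod p) ℂ} (hχ : χ ≠ 1)
    {X : Type*} [Fintype X] (v : X → ZMod p) {E D : ℕ}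
    (hE : ∀ u : ZMod p, u ≠ 0 →
      (p - 1) * (Finset.univ.filter fun x => v x = u).card ≤ Fintype.card X + E)
    (hD : (Finset.univ.filter fun x => v x = 0).card ≤ D) :
    ‖∑ x, χ (v x)‖ ≤ E + D := by
  classical
  have hp2 : 2 ≤ p := (Fact.out : p.Prime).two_le
  set N : ZMod p → ℕ := fun u => (Finset.univ.filter fun x => v x = u).card with hN
  have hsum : ∑ x, χ (v x) = ∑ u, (N u : ℂ) * χ u := by
    rw [← Finset.sum_fiberwise (s := Finset.univ) (g := v)]
    refine Finset.sum_congr rfl fun u _ => ?_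
    rw [Finset.sum_congr rfl (g := fun _ => χ u)
      (fun x hx => by rw [(Finset.mem_filter.mp hx).2])]
    simp [hN]
  have htot : ∑ u, N u = Fintype.card X := by
    rw [← Finset.card_univ]
    exact (Finset.card_eq_sum_card_fiberwise (fun _ _ => Finset.mem_univ _)).symm
  set d : ℕ := p - 1 with hd
  have hdpos : (0 : ℝ) < d := by
    have : 0 < d := by omega
    exact_mod_cast this
  have key : (d : ℂ) * ∑ x, χ (v x)
      = ∑ u ∈ Finset.univ.erase (0 : ZMod p), ((d : ℂ) * N u - (Fintype.card X + E)) * χ u := by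
    rw [Finset.sum_erase _ (by rw [MulChar.map_zero, mul_zero])]
    simp only [sub_mul, Finset.sum_sub_distrib, ← Finset.mul_sum, mul_assoc]
    rw [MulChar.sum_eq_zero_of_ne_one hχ, hsum]
    simp
  have hbd : (d : ℝ) * ‖∑ x, χ (v x)‖ ≤ d * (E + D) := by
    calc (d : ℝ) * ‖∑ x, χ (v x)‖ = ‖(d : ℂ) * ∑ x, χ (v x)‖ := by simp
      _ ≤ ∑ u ∈ Finset.univ.erase (0 : ZMod p), ((Fintype.card X + E : ℝ) - d * N u) := by
        rw [key]
        refine norm_sum_le_of_le _ fun u hu => ?_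
        have hu0 : u ≠ 0 := (Finset.mem_erase.mp hu).1
        have h1 : (d : ℝ) * N u ≤ Fintype.card X + E := by exact_mod_cast hE u hu0
        have h2 : ((d : ℂ) * N u - (Fintype.card X + E))
            = (((d : ℝ) * N u - (Fintype.card X + E) : ℝ) : ℂ) := by push_cast; ring
        rw [norm_mul, h2, Complex.norm_real, Real.norm_eq_abs, abs_of_nonpos (by linarith)]
        have h3 : ‖χ u‖ ≤ 1 := DirichletCharacter.norm_le_one χ u
        nlinarith [norm_nonneg (χ u)]
      _ = d * (E + N 0) := by
        have h1 : (Finset.univ.erase (0 : ZMod p)).card = d := by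
          rw [Finset.card_erase_of_mem (Finset.mem_univ _), Finset.card_univ, ZMod.card]
        have h2 : (∑ u ∈ Finset.univ.erase (0 : ZMod p), (N u : ℝ)) + N 0 = Fintype.card X := by
          rw [Finset.sum_erase_add _ _ (Finset.mem_univ _)]; exact_mod_cast htot
        rw [Finset.sum_sub_distrib, ← Finset.mul_sum, Finset.sum_const, h1, nsmul_eq_mul,
          ← h2]
        ring
      _ ≤ d * (E + D) := by
        have : (N 0 : ℝ) ≤ D := by exact_mod_cast hD
        gcongr
  exact le_of_mul_le_mul_left hbd hdpos

open Polynomial in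
/-- A square-root bound, with an unspecified constant, for character sums over the extensions
of even degree of the prime field. -/
theorem exists_norm_sum_mulChar_norm_le {p : ℕ} [Fact p.Prime] (hp : p ≠ 2)
    {χ : MulChar (ZMod p) ℂ} (hχ : χ ≠ 1) {g : (ZMod p)[X]} {a : ZMod p} (hg : g.eval a ≠ 0) :
    ∃ c : ℝ, ∀ (k : ℕ) (K : Type) [Field K] [Fintype K] [Algebra (ZMod p) K], 1 ≤ k →
      Fintype.card K = p ^ (2 * k) →
      ‖∑ x : K, χ (Algebra.norm (ZMod p) (aeval x ((X - C a) * g)))‖ ≤ c * (p : ℝ) ^ k := by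
  have hp2 : 2 ≤ p := (Fact.out : p.Prime).two_le
  set D := (X * g).natDegree with hD
  refine ⟨((p - 1 : ℕ) * (4 * D + 6) + D : ℕ), fun k K _ _ _ hk hK => ?_⟩
  classical
  have : CharP K p := charP_of_injective_algebraMap (algebraMap (ZMod p) K).injective p
  set s := p ^ k with hs
  have hcard : Fintype.card K = s ^ 2 := by rw [hK, hs, ← pow_mul, mul_comm]
  set d := p - 1 with hd
  have hdpos : 0 < d := by omega
  have hps : p ≤ s := by
    calc p = p ^ 1 := (pow_one p).symm
      _ ≤ p ^ k := Nat.pow_le_pow_right (by omega) hk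
  obtain ⟨σ, hσ⟩ : d ∣ s - 1 := by simpa using Nat.sub_dvd_pow_sub_pow p 1 k
  have hσ' : d * σ + 1 = s := by omega
  have hnorm : ∀ y : K, algebraMap (ZMod p) K (Algebra.norm (ZMod p) y) = y ^ (σ * (s + 1)) := by
    intro y
    rw [FiniteField.algebraMap_norm_eq_pow]
    congr 1
    rw [Nat.card_eq_fintype_card, Nat.card_eq_fintype_card, ZMod.card, hcard]
    apply Nat.div_eq_of_eq_mul_right hdpos
    have : s ^ 2 = d * (σ * (s + 1)) + 1 := by rw [← mul_assoc, ← hσ']; ring_nf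
    omega
  set G : K[X] := (g.comp (X + C a)).map (algebraMap (ZMod p) K) with hG
  have hG0 : G.coeff 0 ≠ 0 := by
    rw [hG, coeff_map, coeff_zero_eq_eval_zero, eval_comp]
    simpa using hg
  have hGD : (X * G).natDegree ≤ D := by
    have hgne : g ≠ 0 := by rintro rfl; simp at hg
    have hGne : G ≠ 0 := by rintro h; simp [h] at hG0
    rw [hD, natDegree_X_mul hgne, natDegree_X_mul hGne, hG]
    refine Nat.succ_le_succ (natDegree_map_le.trans ?_)
    rw [natDegree_comp]; simp
  have heval : ∀ x : K, aeval (x + algebraMap (ZMod p) K a) ((X - C a) * g)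
      = (X * G).eval x := by
    intro x
    simp [hG, eval_map, eval₂_comp, aeval_def, eval₂_mul]
  rw [← Equiv.sum_comp (Equiv.addRight (algebraMap (ZMod p) K a))]
  simp only [Equiv.coe_addRight, heval]
  have hcount : ∀ u : ZMod p, (Finset.univ.filter fun x : K =>
      Algebra.norm (ZMod p) ((X * G).eval x) = u)
      = Finset.univ.filter fun x : K => (X * G).eval x ^ (σ * (s + 1))
        = algebraMap (ZMod p) K u := by
    intro u
    ext x
    simp only [Finset.mem_filter, Finset.mem_univ, true_and, ← hnorm]
    exact (algebraMap (ZMod p) K).injective.eq_iff.symm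
  have main := norm_sum_mulChar_comp_le hχ
    (fun x : K => Algebra.norm (ZMod p) ((X * G).eval x)) (E := d * (4 * D + 6) * s) (D := D)
    (fun u hu => by
      rw [hcount, hcard]
      exact card_eval_pow_eq_le (p := p) (k := k) hs hcard (by omega) hσ' hG0 hGD
        (by simpa using hu))
    (by
      have hne : X * G ≠ 0 := by
        refine mul_ne_zero X_ne_zero ?_
        rintro h; simp [h] at hG0
      refine le_trans (Finset.card_le_card (t := (X * G).roots.toFinset) fun x hx => ?_)
        ((Multiset.toFinset_card_le _).trans ((card_roots' _).trans hGD))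
      simp only [Finset.mem_filter, Finset.mem_univ, true_and] at hx
      rw [Algebra.norm_eq_zero_iff] at hx
      simpa [hne] using hx)
  refine main.trans ?_
  have h1 : (1 : ℝ) ≤ (p : ℝ) ^ k := one_le_pow₀ (by exact_mod_cast (by omega : 1 ≤ p))
  have h2 : (D : ℝ) * 1 ≤ D * (p : ℝ) ^ k := by gcongr
  push_cast [hs]
  linarith

open Polynomial in
/-- Newton's recurrence characterizes power sums. -/
theorem exists_eq_neg_sum_pow {c S : ℕ → ℂ} {m : ℕ} (h0 : c 0 = 1) (hc : ∀ k, m < k → c k = 0)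
    (hrec : ∀ k, k * c k =
      ∑ x ∈ Finset.HasAntidiagonal.antidiagonal k with x.1 < k, c x.1 * S x.2) :
    ∃ ω : Fin m → ℂ, ∀ n, 1 ≤ n → S n = -∑ i, ω i ^ n := by
  classical
  set P : ℂ[X] := ∑ k ∈ Finset.range (m + 1), C (c k) * X ^ (m - k) with hP
  have hcoeff : ∀ k, k ≤ m → P.coeff (m - k) = c k := by
    intro k hk
    rw [hP, finsetSum_coeff, Finset.sum_eq_single k]
    · simp
    · intro j hj hjk
      have := Finset.mem_range.mp hj
      rw [coeff_C_mul, coeff_X_pow, if_neg (by omega), mul_zero]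
    · intro h; exact absurd (Finset.mem_range.mpr (by omega)) h
  have hle : P.natDegree ≤ m := natDegree_sum_le_of_forall_le _ _ fun k _ =>
    (natDegree_C_mul_X_pow_le _ _).trans (Nat.sub_le _ _)
  have hlead : P.coeff m = 1 := by simpa [h0] using hcoeff 0 (Nat.zero_le _)
  have hmonic : P.Monic := monic_of_natDegree_le_of_coeff_eq_one m hle hlead
  have hdeg : P.natDegree = m := le_antisymm hle (le_natDegree_of_ne_zero (by rw [hlead]; simp))
  have hcard : P.roots.card = m := by
    rw [← hdeg]; exact (splits_iff_card_roots.mp (IsAlgClosed.splits P))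
  obtain ⟨ω, hω⟩ : ∃ ω : Fin m → ℂ, Multiset.map ω Finset.univ.val = P.roots := by
    have hl : P.roots.toList.length = m := by simpa using hcard
    refine ⟨fun i => P.roots.toList.get (i.cast hl.symm), ?_⟩
    conv_rhs => rw [← Multiset.coe_toList P.roots]
    rw [Fin.univ_val_map]
    exact congrArg _ (List.ext_getElem (by simp [hl]) (by simp))
  refine ⟨ω, ?_⟩
  have hes : ∀ k, MvPolynomial.aeval ω (MvPolynomial.esymm (Fin m) ℂ k) = (-1) ^ k * c k := by
    intro k
    rw [MvPolynomial.aeval_esymm_eq_multiset_esymm, hω]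
    by_cases hk : k ≤ m
    · have h1 := coeff_eq_esymm_roots_of_splits (IsAlgClosed.splits P) (k := m - k)
        (by rw [hdeg]; omega)
      rw [hcoeff k hk, hmonic.leadingCoeff, hdeg, Nat.sub_sub_self hk, one_mul] at h1
      rw [h1, ← mul_assoc, ← mul_pow]
      simp
    · rw [hc k (by omega), mul_zero, Multiset.esymm, Multiset.powersetCard_eq_empty]
      · simp
      · omega
  have hnewton : ∀ k : ℕ, k * c k
      = -∑ x ∈ Finset.HasAntidiagonal.antidiagonal k with x.1 < k, c x.1 * ∑ i, ω i ^ x.2 := by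
    intro k
    have hs : ∀ j : ℕ, ((-1 : ℂ) ^ j) * (-1) ^ j = 1 := fun j => by rw [← mul_pow]; simp
    have h : k * ((-1) ^ k * c k) = (-1) ^ (k + 1) *
        ∑ x ∈ Finset.HasAntidiagonal.antidiagonal k with x.1 < k, c x.1 * ∑ i, ω i ^ x.2 := by
      have h := congrArg (MvPolynomial.aeval ω) (MvPolynomial.mul_esymm_eq_sum (Fin m) ℂ k)
      simp only [map_mul, map_sum, map_pow, map_neg, map_one, map_natCast, hes,
        MvPolynomial.psum, MvPolynomial.aeval_X] at h
      rw [h]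
      congr 1
      refine Finset.sum_congr rfl fun x _ => ?_
      rw [← mul_assoc ((-1 : ℂ) ^ x.1), hs, one_mul]
    have h3 := congrArg (fun t => (-1) ^ k * t) h
    calc k * c k = ((-1) ^ k * (-1) ^ k) * (k * c k) := by rw [hs, one_mul]
      _ = (-1) ^ k * (k * ((-1) ^ k * c k)) := by ring
      _ = _ := by rw [h3, pow_succ, ← mul_assoc, ← mul_assoc, hs]; ring
  intro n
  induction n using Nat.strong_induction_on with
  | _ n ih =>
    intro hn
    have h1 := (hrec n).symm.trans (hnewton n)
    have hmem : (0, n) ∈ (Finset.HasAntidiagonal.antidiagonal n).filter fun x => x.1 < n := by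
      simp; omega
    rw [← Finset.add_sum_erase _ _ hmem, ← Finset.add_sum_erase _ _ hmem, neg_add, h0,
      one_mul, one_mul] at h1
    have h2 : ∑ x ∈ ((Finset.HasAntidiagonal.antidiagonal n).filter fun x => x.1 < n).erase (0, n),
        c x.1 * S x.2
        = ∑ x ∈ ((Finset.HasAntidiagonal.antidiagonal n).filter fun x => x.1 < n).erase (0, n),
          -(c x.1 * ∑ i, ω i ^ x.2) := by
      refine Finset.sum_congr rfl fun x hx => ?_
      simp only [Finset.mem_erase, Finset.mem_filter, Finset.HasAntidiagonal.mem_antidiagonal,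
        ne_eq, Prod.ext_iff, not_and] at hx
      rw [ih x.2 (by omega) (by omega)]
      ring
    rw [h2, Finset.sum_neg_distrib] at h1
    exact add_right_cancel h1

open Polynomial in
/-- If the power sums of finitely many complex numbers are `O(R ^ k)`, then these numbers have
absolute value at most `R`. -/
theorem norm_le_of_norm_sum_pow_le {ι : Type*} [Fintype ι] {z : ι → ℂ} {c R : ℝ} (hR : 0 < R)
    (h : ∀ k : ℕ, 1 ≤ k → ‖∑ i, z i ^ k‖ ≤ c * R ^ k) (i : ι) : ‖z i‖ ≤ R := by
  classical
  set P : ℂ[X] := ∏ w ∈ (Finset.univ.image z).erase (z i), (X - C w) with hP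
  have hPi : P.eval (z i) ≠ 0 := by
    rw [hP, eval_prod, Finset.prod_ne_zero_iff]
    intro w hw
    simpa [sub_eq_zero] using (Finset.mem_erase.mp hw).1.symm
  have hPj : ∀ j, z j ≠ z i → P.eval (z j) = 0 := by
    intro j hj
    rw [hP, eval_prod]
    exact Finset.prod_eq_zero (Finset.mem_erase.mpr ⟨hj, by simp⟩) (by simp)
  set N : ℕ := (Finset.univ.filter fun j => z j = z i).card with hN
  have hNpos : 0 < N := Finset.card_pos.mpr ⟨i, by simp⟩
  have hid : ∀ k : ℕ, ∑ t ∈ Finset.range (P.natDegree + 1), P.coeff t * ∑ j, z j ^ (k + t)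
      = N * (P.eval (z i) * z i ^ k) := by
    intro k
    simp only [Finset.mul_sum]
    rw [Finset.sum_comm]
    have : ∀ j, ∑ t ∈ Finset.range (P.natDegree + 1), P.coeff t * z j ^ (k + t)
        = P.eval (z j) * z j ^ k := by
      intro j
      rw [eval_eq_sum_range, Finset.sum_mul]
      exact Finset.sum_congr rfl fun t _ => by rw [pow_add]; ring
    simp only [this]
    rw [← Finset.sum_filter_add_sum_filter_not _ (fun j => z j = z i)]
    rw [Finset.sum_congr rfl (g := fun _ => P.eval (z i) * z i ^ k)
      (fun j hj => by rw [(Finset.mem_filter.mp hj).2]),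
      Finset.sum_eq_zero (s := Finset.univ.filter fun j => ¬ z j = z i)
      (fun j hj => by rw [hPj j (Finset.mem_filter.mp hj).2, zero_mul])]
    simp [hN]
  set c' : ℝ := ∑ t ∈ Finset.range (P.natDegree + 1), ‖P.coeff t‖ * (c * R ^ t) with hc'
  have hbound : ∀ k : ℕ, 1 ≤ k → (N * ‖P.eval (z i)‖) * ‖z i‖ ^ k ≤ c' * R ^ k := by
    intro k hk
    have h1 : (N * ‖P.eval (z i)‖) * ‖z i‖ ^ k
        = ‖∑ t ∈ Finset.range (P.natDegree + 1), P.coeff t * ∑ j, z j ^ (k + t)‖ := by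
      rw [hid]; simp [mul_assoc]
    rw [h1, hc', Finset.sum_mul]
    refine norm_sum_le_of_le _ fun t _ => ?_
    rw [norm_mul, mul_assoc, mul_assoc, ← pow_add, add_comm t k]
    exact mul_le_mul_of_nonneg_left (h _ (by omega)) (norm_nonneg _)
  by_contra! hlt
  have hq : 1 < ‖z i‖ / R := (one_lt_div hR).mpr hlt
  have hpos : 0 < N * ‖P.eval (z i)‖ := by positivity
  obtain ⟨k, hk⟩ := pow_unbounded_of_one_lt (c' / (N * ‖P.eval (z i)‖)) hq
  have hk' : c' / (N * ‖P.eval (z i)‖) < (‖z i‖ / R) ^ (k + 1) :=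
    hk.trans_le (pow_le_pow_right₀ hq.le (Nat.le_succ k))
  have h2 := hbound (k + 1) (by omega)
  rw [div_pow, div_lt_div_iff₀ hpos (by positivity)] at hk'
  linarith [mul_comm (‖z i‖ ^ (k + 1)) (N * ‖P.eval (z i)‖)]

section MonicSums

open Polynomial

variable (F : Type*) [Field F] [Fintype F]

theorem finite_monic_natDegree_eq (k : ℕ) : {g : F[X] | g.Monic ∧ g.natDegree = k}.Finite := by
  refine Set.Finite.of_finite_image (f := fun g : F[X] => fun i : Fin (k + 1) => g.coeff i)
    (Set.toFinite _) ?_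
  rintro g ⟨_, hg⟩ h ⟨_, hh⟩ hgh
  ext n
  by_cases hn : n < k + 1
  · exact congrFun hgh ⟨n, hn⟩
  · rw [coeff_eq_zero_of_natDegree_lt (by omega), coeff_eq_zero_of_natDegree_lt (by omega)]

/-- The monic polynomials of degree `k` over a finite field. -/
noncomputable def monicOfDegree (k : ℕ) : Finset F[X] :=
  (finite_monic_natDegree_eq F k).toFinset

open Classical in
/-- The monic irreducible polynomials of degree `k` over a finite field. -/
noncomputable def irreducibleOfDegree (k : ℕ) : Finset F[X] :=
  (monicOfDegree F k).filter Irreducible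

variable {F}

@[simp]
theorem mem_monicOfDegree {k : ℕ} {g : F[X]} :
    g ∈ monicOfDegree F k ↔ g.Monic ∧ g.natDegree = k := by
  simp [monicOfDegree]

@[simp]
theorem mem_irreducibleOfDegree {k : ℕ} {g : F[X]} :
    g ∈ irreducibleOfDegree F k ↔ (g.Monic ∧ g.natDegree = k) ∧ Irreducible g := by
  simp [irreducibleOfDegree]

/-- The polynomial analogue of `∑ d ∣ n, Λ d = log n`. -/
theorem natDegree_eq_sum_irreducible {k : ℕ} {g : F[X]} (hg : g ∈ monicOfDegree F k)
    [∀ q h : F[X], Decidable (q ∣ h)] :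
    k = ∑ d ∈ Finset.Icc 1 k, ∑ P ∈ irreducibleOfDegree F d, ∑ j ∈ Finset.Icc 1 k,
      if P ^ j ∣ g then d else 0 := by
  classical
  obtain ⟨hm, hk⟩ := mem_monicOfDegree.mp hg
  have hg0 := hm.ne_zero
  set s := UniqueFactorizationMonoid.normalizedFactors g with hs
  have hprod : s.prod = g := by
    have := leadingCoeff_mul_prod_normalizedFactors g
    rwa [hm.leadingCoeff, C_1, one_mul] at this
  have hmem : ∀ P, P ∈ s ↔ Irreducible P ∧ P.Monic ∧ P ∣ g := fun P =>
    Polynomial.mem_normalizedFactors_iff hg0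
  have hdvd : ∀ (P : F[X]) (j : ℕ), P.Monic → Irreducible P → (P ^ j ∣ g ↔ j ≤ s.count P) := by
    intro P j hP hi
    rw [UniqueFactorizationMonoid.dvd_iff_normalizedFactors_le_normalizedFactors
      (pow_ne_zero _ hP.ne_zero) hg0, UniqueFactorizationMonoid.normalizedFactors_pow,
      UniqueFactorizationMonoid.normalizedFactors_irreducible hi,
      Multiset.nsmul_singleton, hP.normalize_eq_self, Multiset.le_count_iff_replicate_le]
  have hdeg : k = ∑ P ∈ s.toFinset, s.count P * P.natDegree := by
    have h0 : (0 : F[X]) ∉ s := UniqueFactorizationMonoid.zero_notMem_normalizedFactors _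
    rw [← hk, ← hprod, natDegree_multiset_prod _ h0, Finset.sum_multiset_map_count]
    simp
  have hle : ∀ P ∈ s, 1 ≤ P.natDegree ∧ s.count P ≤ k := by
    intro P hP
    have h1 : 1 ≤ P.natDegree := ((hmem P).mp hP).1.natDegree_pos
    refine ⟨h1, ?_⟩
    have h2 : s.count P * P.natDegree ≤ k := by
      conv_rhs => rw [hdeg]
      exact Finset.single_le_sum (f := fun P => s.count P * P.natDegree)
        (fun _ _ => Nat.zero_le _) (Multiset.mem_toFinset.mpr hP)
    nlinarith
  rw [Finset.sum_sigma']
  conv_lhs => rw [hdeg]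
  refine Finset.sum_of_injOn (fun P => ⟨P.natDegree, P⟩) ?_ ?_ ?_ ?_
  · intro P _ Q _ h
    simp only [Sigma.mk.injEq] at h
    exact eq_of_heq h.2
  · intro P hP
    have hP' : P ∈ s := by simpa using hP
    obtain ⟨hi, hPm, hd⟩ := (hmem P).mp hP'
    have := natDegree_le_of_dvd hd hg0
    simp only [Finset.coe_sigma, Set.mem_sigma_iff, Finset.mem_coe, Finset.mem_Icc,
      mem_irreducibleOfDegree]
    exact ⟨⟨(hle P hP').1, by omega⟩, ⟨hPm, trivial⟩, hi⟩
  · rintro ⟨d, P⟩ hP hn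
    simp only [Finset.mem_sigma, mem_irreducibleOfDegree] at hP
    obtain ⟨_, ⟨hPm, hPd⟩, hi⟩ := hP
    refine Finset.sum_eq_zero fun j hj => if_neg fun hd => hn ?_
    have hPg : P ∣ g := (dvd_pow_self P (by have := Finset.mem_Icc.mp hj; omega)).trans hd
    refine ⟨P, by simpa using (hmem P).mpr ⟨hi, hPm, hPg⟩, ?_⟩
    simp only [hPd]
  · intro P hP
    have hP' : P ∈ s := by simpa using hP
    obtain ⟨hi, hPm, _⟩ := (hmem P).mp hP'
    simp only [hdvd P _ hPm hi]
    rw [← Finset.sum_filter, Finset.sum_const]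
    have : (Finset.Icc 1 k).filter (fun j => j ≤ s.count P) = Finset.Icc 1 (s.count P) := by
      ext j
      have := (hle P hP').2
      simp only [Finset.mem_filter, Finset.mem_Icc]
      omega
    rw [this]
    simp

/-- The recurrence between the coefficients of the `L`-series of a completely multiplicative
function of monic polynomials and those of its logarithmic derivative. -/
theorem natCast_mul_sum_monicOfDegree (Λ : F[X] →* ℂ) (k : ℕ) :
    k * ∑ g ∈ monicOfDegree F k, Λ g
      = ∑ x ∈ Finset.HasAntidiagonal.antidiagonal k with x.1 < k,
        (∑ g ∈ monicOfDegree F x.1, Λ g) *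
          ∑ y ∈ x.2.divisorsAntidiagonal, ∑ P ∈ irreducibleOfDegree F y.1, y.1 * Λ P ^ y.2 := by
  classical
  set c : ℕ → ℂ := fun k => ∑ g ∈ monicOfDegree F k, Λ g with hc
  have hinner : ∀ (P : F[X]) (d j : ℕ), P.Monic → P.natDegree = d →
      ∑ g ∈ monicOfDegree F k, (if P ^ j ∣ g then Λ g else 0)
        = if d * j ≤ k then Λ P ^ j * c (k - d * j) else 0 := by
    intro P d j hP hd
    have hPd : (P ^ j).natDegree = d * j := by rw [hP.natDegree_pow, hd, mul_comm]
    rw [← Finset.sum_filter]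
    split_ifs with h
    · rw [hc, Finset.mul_sum]
      symm
      refine Finset.sum_nbij (fun g => P ^ j * g) ?_ ?_ ?_ ?_
      · intro g hg
        obtain ⟨hm, hgd⟩ := mem_monicOfDegree.mp hg
        rw [Finset.mem_filter, mem_monicOfDegree, (hP.pow j).natDegree_mul hm, hPd, hgd]
        exact ⟨⟨(hP.pow j).mul hm, by omega⟩, dvd_mul_right _ _⟩
      · intro g _ g' _ hgg
        exact mul_left_cancel₀ (hP.pow j).ne_zero hgg
      · intro g hg
        obtain ⟨hg, q, rfl⟩ := Finset.mem_filter.mp hg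
        obtain ⟨hm, hgd⟩ := mem_monicOfDegree.mp hg
        have hq := (hP.pow j).of_mul_monic_left hm
        rw [(hP.pow j).natDegree_mul hq, hPd] at hgd
        exact ⟨q, mem_monicOfDegree.mpr ⟨hq, by omega⟩, rfl⟩
      · intro g _
        rw [map_mul, map_pow]
    · refine Finset.sum_eq_zero fun g hg => ?_
      obtain ⟨hg, hdvd⟩ := Finset.mem_filter.mp hg
      obtain ⟨hm, hgd⟩ := mem_monicOfDegree.mp hg
      have := natDegree_le_of_dvd hdvd hm.ne_zero
      omega
  have hL : k * c k = ∑ d ∈ Finset.Icc 1 k, ∑ j ∈ Finset.Icc 1 k,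
      if d * j ≤ k then c (k - d * j) * ∑ P ∈ irreducibleOfDegree F d, d * Λ P ^ j else 0 := by
    calc k * c k = ∑ g ∈ monicOfDegree F k, ∑ d ∈ Finset.Icc 1 k,
          ∑ P ∈ irreducibleOfDegree F d, ∑ j ∈ Finset.Icc 1 k,
            d * (if P ^ j ∣ g then Λ g else 0) := by
          rw [hc, Finset.mul_sum]
          refine Finset.sum_congr rfl fun g hg => ?_
          conv_lhs => rw [natDegree_eq_sum_irreducible hg]
          push_cast
          simp only [Finset.sum_mul]
          refine Finset.sum_congr rfl fun d _ => Finset.sum_congr rfl fun P _ =>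
            Finset.sum_congr rfl fun j _ => ?_
          split_ifs <;> simp
      _ = ∑ d ∈ Finset.Icc 1 k, ∑ P ∈ irreducibleOfDegree F d, ∑ j ∈ Finset.Icc 1 k,
            d * ∑ g ∈ monicOfDegree F k, (if P ^ j ∣ g then Λ g else 0) := by
          rw [Finset.sum_comm]
          refine Finset.sum_congr rfl fun d _ => ?_
          rw [Finset.sum_comm]
          refine Finset.sum_congr rfl fun P _ => ?_
          rw [Finset.sum_comm]
          simp only [Finset.mul_sum]
      _ = _ := by
          refine Finset.sum_congr rfl fun d _ => ?_
          rw [Finset.sum_comm]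
          refine Finset.sum_congr rfl fun j _ => ?_
          have : ∀ P ∈ irreducibleOfDegree F d,
              (d : ℂ) * ∑ g ∈ monicOfDegree F k, (if P ^ j ∣ g then Λ g else 0)
              = if d * j ≤ k then c (k - d * j) * (d * Λ P ^ j) else 0 := by
            intro P hP
            obtain ⟨⟨hm, hd⟩, _⟩ := mem_irreducibleOfDegree.mp hP
            rw [hinner P d j hm hd]
            split_ifs <;> ring
          rw [Finset.sum_congr rfl this]
          split_ifs
          · rw [Finset.mul_sum]
          · simp
  rw [hL, ← Finset.sum_product', ← Finset.sum_filter]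
  rw [← Finset.sum_fiberwise_of_maps_to
    (t := (Finset.HasAntidiagonal.antidiagonal k).filter fun x => x.1 < k)
    (g := fun y : ℕ × ℕ => (k - y.1 * y.2, y.1 * y.2))]
  · refine Finset.sum_congr rfl fun x hx => ?_
    obtain ⟨hx1, hx2⟩ := Finset.mem_filter.mp hx
    rw [Finset.HasAntidiagonal.mem_antidiagonal] at hx1
    rw [Finset.mul_sum]
    have hset : ((Finset.Icc 1 k ×ˢ Finset.Icc 1 k).filter fun y => y.1 * y.2 ≤ k).filter
        (fun y => (k - y.1 * y.2, y.1 * y.2) = x) = x.2.divisorsAntidiagonal := by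
      ext ⟨d, j⟩
      simp only [Finset.mem_filter, Finset.mem_product, Finset.mem_Icc, Prod.ext_iff,
        Nat.mem_divisorsAntidiagonal]
      constructor
      · rintro ⟨⟨_, _⟩, _, h⟩
        exact ⟨h, by omega⟩
      · rintro ⟨h, h0⟩
        have hd : 0 < d := Nat.pos_of_ne_zero (by rintro rfl; simp at h; omega)
        have hj : 0 < j := Nat.pos_of_ne_zero (by rintro rfl; simp at h; omega)
        have h1 : d ≤ d * j := Nat.le_mul_of_pos_right _ hj
        have h2 : j ≤ d * j := Nat.le_mul_of_pos_left _ hd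
        omega
    rw [hset]
    refine Finset.sum_congr rfl fun y hy => ?_
    rw [(Nat.mem_divisorsAntidiagonal.mp hy).1, show k - x.2 = x.1 by omega]
  · intro y hy
    simp only [Finset.mem_filter, Finset.mem_product, Finset.mem_Icc] at hy
    have : 0 < y.1 * y.2 := Nat.mul_pos (by omega) (by omega)
    simp only [Finset.mem_filter, Finset.HasAntidiagonal.mem_antidiagonal]
    omega

end MonicSums

section WeilBound

open Polynomial

/-- The norm of `x - a` from a finite-dimensional extension, in terms of the minimal polynomial
of `x`. -/
theorem norm_sub_algebraMap_eq {F K : Type*} [Field F] [Field K] [Algebra F K]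
    [FiniteDimensional F K] (x : K) (a : F) :
    Algebra.norm F (x - algebraMap F K a) = (-1) ^ Module.finrank F K *
      (minpoly F x).eval a ^ (Module.finrank F K / (minpoly F x).natDegree) := by
  set y := x - algebraMap F K a with hy
  have hyi : IsIntegral F y := .of_finite F y
  have hm : minpoly F y = (minpoly F x).comp (X + C a) := minpoly.sub_algebraMap x a
  have hdeg : (minpoly F y).natDegree = (minpoly F x).natDegree := by
    rw [hm, natDegree_comp, natDegree_X_add_C, mul_one]
  have hfin := Module.finrank_mul_finrank F (IntermediateField.adjoin F {y}) K
  rw [IntermediateField.adjoin.finrank hyi, hdeg] at hfin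
  have hpos : 0 < (minpoly F x).natDegree := minpoly.natDegree_pos (.of_finite F x)
  have hgen : Algebra.norm F (IntermediateField.AdjoinSimple.gen F y)
      = (-1) ^ (minpoly F x).natDegree * (minpoly F x).eval a := by
    have := Algebra.PowerBasis.norm_gen_eq_coeff_zero_minpoly
      (IntermediateField.adjoin.powerBasis hyi)
    rw [IntermediateField.adjoin.powerBasis_gen, IntermediateField.adjoin.powerBasis_dim,
      IntermediateField.minpoly_gen, hdeg, coeff_zero_eq_eval_zero] at this
    rw [this, hm]
    simp
  rw [Algebra.norm_eq_norm_adjoin, hgen, mul_pow, ← pow_mul, hfin, ← hfin,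
    Nat.mul_div_cancel_left _ hpos]

/-- Sorting the elements of a finite extension by their minimal polynomial. -/
theorem sum_minpoly_eq {F K : Type*} [Field F] [Fintype F] [Field K] [Fintype K] [Algebra F K]
    (Φ : F[X] → ℂ) :
    ∑ x : K, Φ (minpoly F x) = ∑ d ∈ (Module.finrank F K).divisors,
      ∑ P ∈ irreducibleOfDegree F d, d * Φ P := by
  classical
  have hn : Module.finrank F K ≠ 0 := Module.finrank_pos.ne'
  rw [Finset.sum_sigma']
  rw [← Finset.sum_fiberwise_of_maps_to
    (t := (Module.finrank F K).divisors.sigma fun d => irreducibleOfDegree F d)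
    (g := fun x : K => ⟨(minpoly F x).natDegree, minpoly F x⟩)]
  · refine Finset.sum_congr rfl ?_
    rintro ⟨d, P⟩ hP
    simp only [Finset.mem_sigma, Nat.mem_divisors, mem_irreducibleOfDegree] at hP
    obtain ⟨⟨hd, _⟩, ⟨hm, rfl⟩, hi⟩ := hP
    have hset : (Finset.univ.filter fun x : K =>
        (⟨(minpoly F x).natDegree, minpoly F x⟩ : (_ : ℕ) × F[X]) = ⟨P.natDegree, P⟩)
        = (P.rootSet K).toFinset := by
      ext x
      simp only [Finset.mem_filter, Finset.mem_univ, true_and, Set.mem_toFinset,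
        mem_rootSet, Sigma.mk.injEq]
      constructor
      · rintro ⟨_, h⟩
        rw [← eq_of_heq h]
        exact ⟨minpoly.ne_zero (.of_finite F x), minpoly.aeval F x⟩
      · rintro ⟨_, h⟩
        have := minpoly.eq_of_irreducible_of_monic hi h hm
        rw [← this]
        exact ⟨rfl, HEq.rfl⟩
    have hdvd : P ∣ X ^ Nat.card K - X := by
      rw [Module.natCard_eq_pow_finrank (K := F) (V := K)]
      exact hi.natDegree_dvd_iff_dvd_X_pow_card_pow_sub_X.mp hd
    have hsplit : Splits (P.map (algebraMap F K)) := by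
      refine Splits.of_dvd (Polynomial.splits_X_pow_nat_card_sub_X (K := K)) ?_ ?_
      · exact FiniteField.X_pow_card_sub_X_ne_zero _ Finite.one_lt_card
      · simpa using Polynomial.map_dvd (algebraMap F K) hdvd
    have hsep : P.Separable := PerfectField.separable_of_irreducible hi
    have hcard := card_rootSet_eq_natDegree hsep hsplit
    rw [Finset.sum_congr (g := fun _ => Φ P) hset fun x hx => ?_, Finset.sum_const,
      Set.toFinset_card, nsmul_eq_mul]
    · rw [← hcard]
    · rw [← hset] at hx
      rw [eq_of_heq (Sigma.mk.inj (Finset.mem_filter.mp hx).2).2]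
  · intro x _
    simp only [Finset.mem_sigma, Nat.mem_divisors, mem_irreducibleOfDegree]
    have hx : IsIntegral F x := .of_finite F x
    exact ⟨⟨minpoly.degree_dvd hx, hn⟩, ⟨minpoly.monic hx, trivial⟩, minpoly.irreducible hx⟩

/-- The completely multiplicative function `g ↦ χ (∏ a ∈ A, g(a) ^ e(a))` of polynomials. -/
noncomputable def evalProdHom {F : Type*} [Field F] (χ : MulChar F ℂ) (A : Finset F)
    (e : F → ℕ) : F[X] →* ℂ where
  toFun g := χ (∏ a ∈ A, g.eval a ^ e a)
  map_one' := by simp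
  map_mul' g h := by simp [mul_pow, Finset.prod_mul_distrib]

theorem evalProdHom_apply {F : Type*} [Field F] (χ : MulChar F ℂ) (A : Finset F)
    (e : F → ℕ) (g : F[X]) : evalProdHom χ A e g = χ (∏ a ∈ A, g.eval a ^ e a) := rfl

/-- The high coefficients of the `L`-series of `evalProdHom χ A e` vanish. -/
theorem sum_monicOfDegree_evalProdHom_eq_zero {F : Type*} [Field F] [Fintype F]
    {χ : MulChar F ℂ} (hχ : χ ≠ 1) {A : Finset F} {e : F → ℕ} {a₀ : F} (ha₀ : a₀ ∈ A)
    (he : e a₀ = 1) {k : ℕ} (hk : A.card ≤ k) :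
    ∑ g ∈ monicOfDegree F k, evalProdHom χ A e g = 0 := by
  classical
  obtain ⟨u, hu⟩ := MulChar.ne_one_iff.mp hχ
  set q : F[X] := ∏ a ∈ A.erase a₀, (X - C a) with hq
  have hqa : q.eval a₀ ≠ 0 := by
    rw [hq, eval_prod, Finset.prod_ne_zero_iff]
    intro a ha
    simpa [sub_eq_zero] using (Finset.ne_of_mem_erase ha).symm
  have hqz : ∀ a ∈ A.erase a₀, q.eval a = 0 := by
    intro a ha
    rw [hq, eval_prod]
    exact Finset.prod_eq_zero ha (by simp)
  have hqd : q.natDegree < k := by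
    rw [hq, natDegree_prod_of_monic _ _ fun a _ => monic_X_sub_C a]
    simp only [natDegree_X_sub_C, Finset.sum_const, smul_eq_mul, mul_one]
    exact (Finset.card_erase_lt_of_mem ha₀).trans_le hk
  let T : F → F[X] → F[X] := fun v g => g + C ((v - 1) * g.eval a₀ / q.eval a₀) * q
  have hT₀ : ∀ v g, (T v g).eval a₀ = v * g.eval a₀ := by
    intro v g
    simp only [T, eval_add, eval_mul, eval_C]
    field_simp
    ring
  have hT : ∀ v g, ∀ a ∈ A.erase a₀, (T v g).eval a = g.eval a := by
    intro v g a ha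
    simp [T, hqz a ha]
  have hTm : ∀ v g, g ∈ monicOfDegree F k → T v g ∈ monicOfDegree F k := by
    intro v g hg
    obtain ⟨hm, hd⟩ := mem_monicOfDegree.mp hg
    have hlt : (C ((v - 1) * g.eval a₀ / q.eval a₀) * q).degree < g.degree := by
      refine degree_lt_degree ((natDegree_C_mul_le _ _).trans_lt ?_)
      omega
    exact mem_monicOfDegree.mpr ⟨hm.add_of_left hlt,
      (natDegree_add_eq_left_of_degree_lt hlt).trans hd⟩
  have hTT : ∀ v w g, v * w = 1 → T v (T w g) = g := by
    intro v w g hvw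
    have h0 : T v (T w g) = g + C ((w - 1) * g.eval a₀ / q.eval a₀) * q
        + C ((v - 1) * (w * g.eval a₀) / q.eval a₀) * q := by
      rw [← hT₀ w g]
    rw [h0, add_assoc, ← add_mul, ← C_add, ← add_div]
    have : (w - 1) * g.eval a₀ + (v - 1) * (w * g.eval a₀) = 0 := by
      linear_combination g.eval a₀ * hvw
    simp [this]
  have hΛ : ∀ g, evalProdHom χ A e (T u g) = χ u * evalProdHom χ A e g := by
    intro g
    simp only [evalProdHom_apply]
    rw [← Finset.mul_prod_erase _ _ ha₀, ← Finset.mul_prod_erase A _ ha₀,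
      Finset.prod_congr rfl fun a ha => by rw [hT u g a ha], hT₀, he, ← map_mul]
    congr 1
    ring
  have hsum : ∑ g ∈ monicOfDegree F k, evalProdHom χ A e g
      = χ u * ∑ g ∈ monicOfDegree F k, evalProdHom χ A e g := by
    rw [Finset.mul_sum]
    symm
    refine Finset.sum_nbij' (T u) (T (u⁻¹ : Fˣ)) (fun g => hTm _ g) (fun g => hTm _ g)
      (fun g _ => hTT _ _ g (by simp)) (fun g _ => hTT _ _ g (by simp)) fun g _ => (hΛ g).symm
  have : (χ u - 1) * ∑ g ∈ monicOfDegree F k, evalProdHom χ A e g = 0 := by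
    linear_combination -hsum
  exact (mul_eq_zero.mp this).resolve_left (sub_ne_zero.mpr hu)

/-- **Weil's bound** for complete sums of a multiplicative character along a polynomial which
splits and has a simple root. -/
theorem norm_sum_mulChar_prod_sub_le {p : ℕ} [Fact p.Prime] (hp : p ≠ 2)
    {χ : MulChar (ZMod p) ℂ} (hχ : χ ≠ 1) {A : Finset (ZMod p)} {e : ZMod p → ℕ} {a₀ : ZMod p}
    (ha₀ : a₀ ∈ A) (he : e a₀ = 1) :
    ‖∑ c, χ (∏ a ∈ A, (a - c) ^ e a)‖ ≤ A.card * √p := by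
  classical
  set Λ := evalProdHom χ A e with hΛ
  set S : ℕ → ℂ := fun n => ∑ y ∈ n.divisorsAntidiagonal,
    ∑ P ∈ irreducibleOfDegree (ZMod p) y.1, y.1 * Λ P ^ y.2 with hS
  have hcard : 1 ≤ A.card := Finset.card_pos.mpr ⟨a₀, ha₀⟩
  obtain ⟨ω, hω⟩ := exists_eq_neg_sum_pow (S := S) (m := A.card - 1)
    (c := fun k => ∑ g ∈ monicOfDegree (ZMod p) k, Λ g)
    (by
      have : monicOfDegree (ZMod p) 0 = {1} := by
        ext g
        rw [mem_monicOfDegree, Finset.mem_singleton]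
        exact ⟨fun h => h.1.natDegree_eq_zero.mp h.2, by rintro rfl; simp⟩
      simp [this])
    (fun k hk => sum_monicOfDegree_evalProdHom_eq_zero hχ ha₀ he (by omega))
    (natCast_mul_sum_monicOfDegree Λ)
  have hS1 : S 1 = ∑ c, χ (∏ a ∈ A, (a - c) ^ e a) := by
    simp only [hS, Nat.divisorsAntidiagonal_one, Finset.sum_singleton, Nat.cast_one, one_mul,
      pow_one]
    symm
    refine Finset.sum_nbij (fun c => X - C c) ?_ ?_ ?_ ?_
    · intro c _
      exact mem_irreducibleOfDegree.mpr
        ⟨⟨monic_X_sub_C c, natDegree_X_sub_C c⟩, irreducible_X_sub_C c⟩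
    · intro c _ d _ h
      simpa using h
    · intro P hP
      obtain ⟨⟨hm, hd⟩, _⟩ := mem_irreducibleOfDegree.mp hP
      refine ⟨-P.coeff 0, by simp, ?_⟩
      rw [hm.eq_X_add_C hd]
      simp
    · intro c _
      simp [hΛ, evalProdHom_apply]
  obtain ⟨b, hb⟩ := exists_norm_sum_mulChar_norm_le hp hχ
    (g := ∏ a ∈ A.erase a₀, (X - C a) ^ e a) (a := a₀) (by
      rw [eval_prod, Finset.prod_ne_zero_iff]
      intro a ha
      simpa [sub_eq_zero] using fun h => absurd h (Finset.ne_of_mem_erase ha).symm)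
  have hpoly : (X - C a₀) * ∏ a ∈ A.erase a₀, (X - C a) ^ e a = ∏ a ∈ A, (X - C a) ^ e a := by
    rw [← Finset.mul_prod_erase _ _ ha₀, he, pow_one]
  have hp0 : (0 : ℝ) < p := by exact_mod_cast (Fact.out : p.Prime).pos
  have hSn : ∀ k, 1 ≤ k → ‖S (2 * k)‖ ≤ b * (p : ℝ) ^ k := by
    intro k hk
    let K := GaloisField p (2 * k)
    have : Fintype K := Fintype.ofFinite K
    have hfr : Module.finrank (ZMod p) K = 2 * k := GaloisField.finrank p (by omega)
    have hc : Fintype.card K = p ^ (2 * k) := by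
      rw [← Nat.card_eq_fintype_card]
      exact GaloisField.card p (2 * k) (by omega)
    have hsum := sum_minpoly_eq (F := ZMod p) (K := K)
      fun P => Λ P ^ (2 * k / P.natDegree)
    rw [hfr] at hsum
    have : S (2 * k) = ∑ x : K, χ (Algebra.norm (ZMod p)
        (aeval x ((X - C a₀) * ∏ a ∈ A.erase a₀, (X - C a) ^ e a))) := by
      rw [hS]
      simp only
      rw [Nat.sum_divisorsAntidiagonal
        (fun d j => ∑ P ∈ irreducibleOfDegree (ZMod p) d, (d : ℂ) * Λ P ^ j)]
      trans ∑ d ∈ (2 * k).divisors, ∑ P ∈ irreducibleOfDegree (ZMod p) d,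
        d * Λ P ^ (2 * k / P.natDegree)
      · refine Finset.sum_congr rfl fun d _ => Finset.sum_congr rfl fun P hP => ?_
        rw [(mem_irreducibleOfDegree.mp hP).1.2]
      rw [← hsum]
      refine Finset.sum_congr rfl fun x _ => ?_
      rw [hpoly, hΛ, evalProdHom_apply, ← map_pow, map_prod, map_prod, ← Finset.prod_pow]
      congr 1
      refine Finset.prod_congr rfl fun a _ => ?_
      rw [map_pow, map_pow, map_sub, aeval_X, aeval_C, norm_sub_algebraMap_eq, hfr,
        (even_two_mul k).neg_one_pow, one_mul, pow_right_comm]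
    rw [this]
    exact hb k K hk hc
  have hωle : ∀ i, ‖ω i‖ ≤ √p := by
    intro i
    have := norm_le_of_norm_sum_pow_le (z := fun i => ω i ^ 2) (c := b) hp0 (fun k hk => by
      have h1 := hSn k hk
      rw [hω (2 * k) (by omega), norm_neg] at h1
      simpa only [pow_mul] using h1) i
    rw [norm_pow] at this
    exact Real.le_sqrt_of_sq_le this
  rw [← hS1, hω 1 le_rfl, norm_neg]
  calc ‖∑ i, ω i ^ 1‖ ≤ ∑ _i : Fin (A.card - 1), √(p : ℝ) :=
        norm_sum_le_of_le _ fun i _ => by rw [pow_one]; exact hωle i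
    _ = ((A.card - 1 : ℕ) : ℝ) * √p := by simp
    _ ≤ A.card * √p := by
        gcongr
        omega

end WeilBound

section Moments

/-- The number of functions with few values. -/
theorem card_piFinset_filter_card_image_le {ι α : Type*} [Fintype ι] [Nonempty ι] [DecidableEq ι]
    [DecidableEq α] (s : Finset α) (r : ℕ) :
    ((Fintype.piFinset fun _ : ι => s).filter
      fun f => (Finset.univ.image f).card ≤ r).card ≤ r ^ Fintype.card ι * s.card ^ r := by
  have hsub : (Fintype.piFinset fun _ : ι => s).filter
      (fun f => (Finset.univ.image f).card ≤ r) ⊆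
      ((Finset.univ : Finset (ι → Fin r)) ×ˢ Fintype.piFinset fun _ : Fin r => s).image
        fun q => q.2 ∘ q.1 := by
    intro f hf
    obtain ⟨hf, hcard⟩ := Finset.mem_filter.mp hf
    rw [Fintype.mem_piFinset] at hf
    obtain ⟨i₀⟩ := ‹Nonempty ι›
    set I := Finset.univ.image f with hI
    have hmem : ∀ i, f i ∈ I := fun i => Finset.mem_image_of_mem _ (Finset.mem_univ i)
    have hIs : ∀ a ∈ I, a ∈ s := by
      intro a ha
      obtain ⟨i, _, rfl⟩ := Finset.mem_image.mp ha
      exact hf i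
    refine Finset.mem_image.mpr ⟨⟨fun i => Fin.castLE hcard (I.equivFin ⟨f i, hmem i⟩),
      fun j => if h : (j : ℕ) < I.card then I.equivFin.symm ⟨j, h⟩ else f i₀⟩, ?_, ?_⟩
    · simp only [Finset.mem_product, Finset.mem_univ, true_and, Fintype.mem_piFinset]
      intro j
      split_ifs
      · exact hIs _ (Subtype.prop _)
      · exact hf i₀
    · funext i
      simp
  refine (Finset.card_le_card hsub).trans (Finset.card_image_le.trans ?_)
  simp [Finset.card_product]

/-- Complete sums of products of shifts of a character, where one shift occurs only once. -/
theorem norm_sum_mulChar_prod_le_of_unique {p : ℕ} [Fact p.Prime] (hp : p ≠ 2)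
    {χ : MulChar (ZMod p) ℂ} (hχ : χ ≠ 1) {ι : Type*} [Fintype ι] (f : ι → ZMod p) (w : ι → ℕ)
    {i₀ : ι} (hi₀ : ∀ i, f i = f i₀ → i = i₀) (hw : w i₀ = 1) :
    ‖∑ y, ∏ i, χ ((y + f i) ^ w i)‖ ≤ Fintype.card ι * √p := by
  classical
  set e : ZMod p → ℕ := fun a => ∑ i with f i = a, w i with he
  have h1 : e (f i₀) = 1 := by
    have : (Finset.univ.filter fun i => f i = f i₀) = {i₀} := by
      ext i
      simp only [Finset.mem_filter, Finset.mem_univ, true_and, Finset.mem_singleton]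
      exact ⟨hi₀ i, by rintro rfl; rfl⟩
    simp [he, this, hw]
  have hmem : ∀ i ∈ Finset.univ, f i ∈ Finset.univ.image f := fun i hi =>
    Finset.mem_image_of_mem _ hi
  have key := norm_sum_mulChar_prod_sub_le hp hχ (hmem i₀ (Finset.mem_univ _)) h1
  have hsum : ∑ y, ∏ i, χ ((y + f i) ^ w i)
      = ∑ c, χ (∏ a ∈ Finset.univ.image f, (a - c) ^ e a) := by
    rw [← Equiv.sum_comp (Equiv.neg (ZMod p))]
    refine Finset.sum_congr rfl fun c _ => ?_
    rw [← map_prod, ← Finset.prod_fiberwise_of_maps_to hmem]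
    congr 1
    refine Finset.prod_congr rfl fun a _ => ?_
    rw [he, ← Finset.prod_pow_eq_pow_sum]
    refine Finset.prod_congr rfl fun i hi => ?_
    rw [(Finset.mem_filter.mp hi).2, Equiv.neg_apply, neg_add_eq_sub]
  rw [hsum]
  refine key.trans ?_
  gcongr
  exact Finset.card_image_le

/-- The high moments of short sums of a multiplicative character. -/
theorem sum_norm_sum_mulChar_pow_le {p : ℕ} [Fact p.Prime] (hp : p ≠ 2)
    {χ : MulChar (ZMod p) ℂ} (hχ : χ ≠ 1) (s : Finset (ZMod p)) {r : ℕ} (hr : 1 ≤ r) :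
    ∑ y, ‖∑ b ∈ s, χ (y + b)‖ ^ (2 * r)
      ≤ r ^ (2 * r) * (s.card : ℝ) ^ r * p + 2 * r * (s.card : ℝ) ^ (2 * r) * √p := by
  classical
  have hp3 : 3 ≤ p := by
    have := (Fact.out : p.Prime).two_le
    omega
  have hinv : ∀ x : ZMod p, x⁻¹ = x ^ (p - 2) := by
    intro x
    rcases eq_or_ne x 0 with rfl | hx
    · rw [inv_zero, zero_pow (by omega)]
    · rw [inv_eq_iff_eq_inv, ← mul_eq_one_iff_eq_inv₀ (pow_ne_zero _ hx), ← pow_succ',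
        show p - 2 + 1 = p - 1 by omega, ZMod.pow_card_sub_one_eq_one hx]
  have hχinv : ∀ x : ZMod p, χ⁻¹ x = χ (x ^ (p - 2)) := by
    intro x
    rw [MulChar.inv_apply', hinv]
  have hχinv' : ∀ x : ZMod p, χ⁻¹ (x ^ (p - 2)) = χ x := by
    intro x
    rw [MulChar.inv_apply', ← hinv, inv_inv]
  let ι := Fin r ⊕ Fin r
  have : Nonempty ι := ⟨Sum.inl ⟨0, hr⟩⟩
  let w : ι → ℕ := Sum.elim (fun _ => 1) fun _ => p - 2
  let w' : ι → ℕ := Sum.elim (fun _ => p - 2) fun _ => 1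
  have hι : Fintype.card ι = 2 * r := by simp [ι, two_mul]
  have hexp : ∀ y : ZMod p, ((‖∑ b ∈ s, χ (y + b)‖ ^ (2 * r) : ℝ) : ℂ)
      = ∑ f ∈ Fintype.piFinset fun _ : ι => s, ∏ i, χ ((y + f i) ^ w i) := by
    intro y
    rw [← Finset.prod_univ_sum (fun _ : ι => s) fun i b => χ ((y + b) ^ w i)]
    rw [Fintype.prod_sum_type]
    have hstar : ∑ b ∈ s, χ ((y + b) ^ (p - 2)) = (starRingEnd ℂ) (∑ b ∈ s, χ (y + b)) := by
      rw [map_sum]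
      refine Finset.sum_congr rfl fun b _ => ?_
      rw [← hχinv]
      exact (MulChar.star_apply' χ _).symm
    simp only [w, Sum.elim_inl, Sum.elim_inr, pow_one, Finset.prod_const, Finset.card_univ,
      Fintype.card_fin]
    rw [hstar, ← mul_pow, Complex.mul_conj, Complex.normSq_eq_norm_sq, pow_mul]
    push_cast
    rfl
  have htriv : ∀ f : ι → ZMod p, ‖∑ y, ∏ i, χ ((y + f i) ^ w i)‖ ≤ p := by
    intro f
    refine (norm_sum_le_of_le (f := fun y => ∏ i, χ ((y + f i) ^ w i)) (n := fun _ => (1 : ℝ))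
      _ fun y _ => ?_).trans (by simp [ZMod.card])
    rw [← map_prod]
    exact DirichletCharacter.norm_le_one χ _
  have hgood : ∀ f : ι → ZMod p, ¬ (Finset.univ.image f).card ≤ r →
      ‖∑ y, ∏ i, χ ((y + f i) ^ w i)‖ ≤ 2 * r * √p := by
    intro f hf
    have hex : ∃ i₀, ∀ i, f i = f i₀ → i = i₀ := by
      by_contra! hcon
      refine hf ?_
      have := Finset.mul_card_image_le_card (f := f) (Finset.univ : Finset ι) (n := 2) ?_
      · rw [Finset.card_univ, hι] at this
        omega
      · intro a ha
        obtain ⟨i, _, rfl⟩ := Finset.mem_image.mp ha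
        obtain ⟨j, hj, hji⟩ := hcon i
        exact Finset.one_lt_card.mpr ⟨j, by simp [hj], i, by simp, hji⟩
    obtain ⟨i₀, hi₀⟩ := hex
    have hc : (2 * r : ℝ) = Fintype.card ι := by rw [hι]; push_cast; ring
    rw [hc]
    rcases hcase : i₀ with j | j
    · exact norm_sum_mulChar_prod_le_of_unique hp hχ f w hi₀ (by rw [hcase]; rfl)
    · have heq : ∀ y, ∏ i, χ ((y + f i) ^ w i) = ∏ i, χ⁻¹ ((y + f i) ^ w' i) := by
        intro y
        refine Finset.prod_congr rfl fun i _ => ?_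
        rcases i with i | i
        · simp only [w, w', Sum.elim_inl, pow_one]
          rw [hχinv']
        · simp only [w, w', Sum.elim_inr, pow_one]
          rw [hχinv]
      simp only [heq]
      exact norm_sum_mulChar_prod_le_of_unique hp (inv_ne_one.mpr hχ) f w' hi₀
        (by rw [hcase]; rfl)
  have hmain : ((∑ y, ‖∑ b ∈ s, χ (y + b)‖ ^ (2 * r) : ℝ) : ℂ)
      = ∑ f ∈ Fintype.piFinset fun _ : ι => s, ∑ y, ∏ i, χ ((y + f i) ^ w i) := by
    rw [Finset.sum_comm, Complex.ofReal_sum]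
    exact Finset.sum_congr rfl fun y _ => hexp y
  have hnn : 0 ≤ ∑ y, ‖∑ b ∈ s, χ (y + b)‖ ^ (2 * r) :=
    Finset.sum_nonneg fun _ _ => by positivity
  rw [← abs_of_nonneg hnn, ← Real.norm_eq_abs, ← Complex.norm_real, hmain,
    ← Finset.sum_filter_add_sum_filter_not _ fun f => (Finset.univ.image f).card ≤ r]
  refine (norm_add_le _ _).trans (add_le_add ?_ ?_)
  · refine (norm_sum_le_of_le _ fun f _ => htriv f).trans ?_
    rw [Finset.sum_const, nsmul_eq_mul]
    gcongr
    have := card_piFinset_filter_card_image_le (ι := ι) s r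
    rw [hι] at this
    exact_mod_cast this
  · refine (norm_sum_le_of_le _ fun f hf => hgood f (Finset.mem_filter.mp hf).2).trans ?_
    rw [Finset.sum_const, nsmul_eq_mul]
    have hcard : (((Fintype.piFinset fun _ : ι => s).filter
        fun f => ¬ (Finset.univ.image f).card ≤ r).card : ℝ) ≤ (s.card : ℝ) ^ (2 * r) := by
      have := Finset.card_filter_le (Fintype.piFinset fun _ : ι => s)
        fun f => ¬ (Finset.univ.image f).card ≤ r
      rw [Fintype.card_piFinset, Finset.prod_const, Finset.card_univ, hι] at this
      exact_mod_cast this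
    calc _ ≤ (s.card : ℝ) ^ (2 * r) * (2 * r * √p) := by gcongr
      _ = _ := by ring

end Moments

section Multiplicities

theorem sum_gcd_le (a : ℕ) : ∑ b ∈ Finset.Ioc 0 a, a.gcd b ≤ a * a.divisors.card := by
  calc ∑ b ∈ Finset.Ioc 0 a, a.gcd b
      ≤ ∑ b ∈ Finset.Ioc 0 a, ∑ g ∈ a.divisors, if g ∣ b then g else 0 := by
        refine Finset.sum_le_sum fun b hb => ?_
        have ha : a ≠ 0 := by
          have := Finset.mem_Ioc.mp hb
          omega
        rw [← Finset.sum_filter]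
        exact Finset.single_le_sum (f := fun g => g) (fun _ _ => Nat.zero_le _)
          (Finset.mem_filter.mpr ⟨Nat.mem_divisors.mpr ⟨Nat.gcd_dvd_left a b, ha⟩,
            Nat.gcd_dvd_right a b⟩)
    _ = ∑ g ∈ a.divisors, a / g * g := by
        rw [Finset.sum_comm]
        refine Finset.sum_congr rfl fun g _ => ?_
        rw [← Finset.sum_filter, Finset.sum_const, Nat.Ioc_filter_dvd_card_eq_div, smul_eq_mul]
    _ = a * a.divisors.card := by
        rw [Finset.sum_congr rfl fun g hg => Nat.div_mul_cancel (Nat.dvd_of_mem_divisors hg)]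
        simp [mul_comm]

theorem sum_card_divisors_le (A : ℕ) :
    ∑ a ∈ Finset.Ioc 0 A, (a.divisors.card : ℝ) ≤ A * (1 + Real.log A) := by
  have h1 : ∑ a ∈ Finset.Ioc 0 A, a.divisors.card = ∑ a ∈ Finset.Ioc 0 A, A / a := by
    rw [← ArithmeticFunction.sum_Ioc_sigma0_eq_sum_div]
    exact Finset.sum_congr rfl fun a _ => (ArithmeticFunction.sigma_zero_apply a).symm
  have h2 : (harmonic A : ℝ) = ∑ a ∈ Finset.Ioc 0 A, (a : ℝ)⁻¹ := by
    rw [harmonic_eq_sum_Icc]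
    push_cast
    rfl
  calc ∑ a ∈ Finset.Ioc 0 A, (a.divisors.card : ℝ) = ∑ a ∈ Finset.Ioc 0 A, ((A / a : ℕ) : ℝ) := by
        exact_mod_cast h1
    _ ≤ ∑ a ∈ Finset.Ioc 0 A, A * (a : ℝ)⁻¹ := by
        refine Finset.sum_le_sum fun a _ => ?_
        rw [← div_eq_mul_inv]
        exact Nat.cast_div_le
    _ = A * harmonic A := by rw [h2, Finset.mul_sum]
    _ ≤ A * (1 + Real.log A) := by
        gcongr
        exact harmonic_le_one_add_log A

theorem card_Ioc_filter_modEq_le (M N v : ℕ) {r : ℕ} (hr : 0 < r) :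
    (((Finset.Ioc M (M + N)).filter fun n => n ≡ v [MOD r]).card : ℝ) ≤ 1 + N / r := by
  have h := Nat.Ioc_filter_modEq_card M (M + N) hr v
  set c := ((Finset.Ioc M (M + N)).filter fun n => n ≡ v [MOD r]).card
  have hq : (c : ℚ) ≤ 1 + N / r := by
    have h1 : (c : ℚ) = max (⌊(((M + N : ℕ) : ℚ) - v) / r⌋ - ⌊((M : ℚ) - v) / r⌋ : ℚ) 0 := by
      exact_mod_cast h
    rw [h1]
    refine max_le ?_ (by positivity)
    have h2 := Int.floor_le ((((M + N : ℕ) : ℚ) - v) / r)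
    have h3 := Int.lt_floor_add_one (((M : ℚ) - v) / r)
    have h4 : (((M + N : ℕ) : ℚ) - v) / r = ((M : ℚ) - v) / r + N / r := by
      push_cast
      ring
    linarith
  have := (Rat.cast_le (K := ℝ)).mpr hq
  push_cast at this
  exact this

/-- The solutions of a linear congruence in two short intervals lie on a line. -/
theorem card_linear_congruence_le {p A N M a b : ℕ} (hN : 1 ≤ N) (hAN : 2 * A * N ≤ p)
    (ha : a ∈ Finset.Ioc 0 A) (hb : b ∈ Finset.Ioc 0 A) :
    (((Finset.Ioc M (M + N) ×ˢ Finset.Ioc M (M + N)).filter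
      fun q : ℕ × ℕ => (q.1 : ZMod p) * b = q.2 * a).card : ℝ) ≤ 1 + N * (a.gcd b / a) := by
  set s := (Finset.Ioc M (M + N) ×ˢ Finset.Ioc M (M + N)).filter
      fun q : ℕ × ℕ => (q.1 : ZMod p) * b = q.2 * a with hs
  rw [Finset.mem_Ioc] at ha hb
  rcases s.eq_empty_or_nonempty with he | ⟨⟨n₀, m₀⟩, h₀⟩
  · rw [he]
    simp only [Finset.card_empty, Nat.cast_zero]
    positivity
  set g := a.gcd b with hg
  have hg0 : 0 < g := Nat.gcd_pos_of_pos_left _ ha.1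
  obtain ⟨α, hα⟩ : g ∣ a := Nat.gcd_dvd_left a b
  obtain ⟨β, hβ⟩ : g ∣ b := Nat.gcd_dvd_right a b
  have hαpos : 0 < α := Nat.pos_of_ne_zero (by rintro rfl; simp at hα; omega)
  have hcop : IsCoprime (α : ℤ) (β : ℤ) := by
    rw [Nat.isCoprime_iff_coprime]
    have := Nat.coprime_div_gcd_div_gcd (m := a) (n := b) hg0
    rwa [← hg, Nat.div_eq_of_eq_mul_right hg0 hα, Nat.div_eq_of_eq_mul_right hg0 hβ] at this
  have hline : ∀ q ∈ s, ((q.1 : ℤ) - n₀) * b = ((q.2 : ℤ) - m₀) * a := by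
    rintro ⟨n, m⟩ hq
    simp only [hs, Finset.mem_filter, Finset.mem_product, Finset.mem_Ioc] at hq h₀
    have hd : (p : ℤ) ∣ ((n : ℤ) - n₀) * b - ((m : ℤ) - m₀) * a := by
      rw [← ZMod.intCast_zmod_eq_zero_iff_dvd]
      push_cast
      linear_combination hq.2 - h₀.2
    have hbd : ∀ x y c : ℕ, M < x → x ≤ M + N → M < y → y ≤ M + N → c ≤ A →
        |((x : ℤ) - y) * c| ≤ (N - 1) * A := by
      intro x y c h1 h2 h3 h4 h5
      rw [abs_mul, Nat.abs_cast]
      have : |(x : ℤ) - y| ≤ N - 1 := abs_le.mpr ⟨by omega, by omega⟩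
      have h6 : (c : ℤ) ≤ A := by exact_mod_cast h5
      have h7 : (0 : ℤ) ≤ N - 1 := by omega
      gcongr
    have h1 := hbd n n₀ b (by omega) (by omega) (by omega) (by omega) hb.2
    have h2 := hbd m m₀ a (by omega) (by omega) (by omega) (by omega) ha.2
    have h3 := abs_sub (((n : ℤ) - n₀) * b) (((m : ℤ) - m₀) * a)
    have h4 : (2 * A * N : ℤ) ≤ p := by exact_mod_cast hAN
    have h5 : (1 : ℤ) ≤ A := by omega
    have := Int.eq_zero_of_abs_lt_dvd hd (by nlinarith)
    exact sub_eq_zero.mp this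
  have hcard : s.card ≤ ((Finset.Ioc M (M + N)).filter fun n => n ≡ n₀ [MOD α]).card := by
    refine Finset.card_le_card_of_injOn Prod.fst ?_ ?_
    · intro q hq
      have h1 := hline q hq
      simp only [hs, Finset.coe_filter, Finset.mem_product, Set.mem_ofPred_eq] at hq
      simp only [Finset.coe_filter, Set.mem_ofPred_eq]
      refine ⟨hq.1.1, ?_⟩
      have h2 : ((q.1 : ℤ) - n₀) * β = ((q.2 : ℤ) - m₀) * α := by
        have hg' : (g : ℤ) ≠ 0 := by exact_mod_cast hg0.ne'
        apply mul_left_cancel₀ hg'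
        rw [hα, hβ] at h1
        push_cast at h1
        linear_combination h1
      have h3 : (α : ℤ) ∣ (q.1 : ℤ) - n₀ :=
        hcop.dvd_of_dvd_mul_right (h2 ▸ dvd_mul_left _ _)
      exact ((Nat.modEq_iff_dvd).mpr h3).symm
    · rintro ⟨n, m⟩ hq ⟨n', m'⟩ hq' h
      simp only at h
      subst h
      have h1 := hline _ hq
      have h2 := hline _ hq'
      simp only at h1 h2
      have ha' : (a : ℤ) ≠ 0 := by omega
      have := mul_right_cancel₀ ha' (h1.symm.trans h2)
      have h3 : m = m' := by omega
      rw [h3]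
  have hratio : (g : ℝ) / a = 1 / α := by
    rw [hα]
    push_cast
    field_simp
  calc (s.card : ℝ) ≤ _ := Nat.cast_le.mpr hcard
    _ ≤ 1 + N / α := card_Ioc_filter_modEq_le M N n₀ hαpos
    _ = 1 + N * (g / a) := by rw [hratio]; ring

/-- The mean square of the number of representations of a residue class as a quotient of an
element of a short interval by a small integer. -/
theorem sum_card_div_eq_sq_le {p A N M : ℕ} [Fact p.Prime] (hN : 1 ≤ N)
    (hAN : 2 * A * N ≤ p) :
    ∑ y : ZMod p, (((Finset.Ioc 0 A ×ˢ Finset.Ioc M (M + N)).filter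
      fun q : ℕ × ℕ => (q.2 : ZMod p) / q.1 = y).card : ℝ) ^ 2
      ≤ A ^ 2 + 2 * N * (A * (1 + Real.log A)) := by
  set I := Finset.Ioc M (M + N) with hI
  set J := Finset.Ioc 0 A with hJ
  have hne : ∀ a ∈ J, (a : ZMod p) ≠ 0 := by
    intro a ha h
    rw [hJ, Finset.mem_Ioc] at ha
    rw [ZMod.natCast_eq_zero_iff] at h
    have := Nat.le_of_dvd ha.1 h
    nlinarith
  set c : ℕ → ℕ → ℝ := fun a b =>
    ((I ×ˢ I).filter fun q : ℕ × ℕ => (q.1 : ZMod p) * b = q.2 * a).card with hc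
  have hsum : ∑ y : ZMod p, (((J ×ˢ I).filter
      fun q : ℕ × ℕ => (q.2 : ZMod p) / q.1 = y).card : ℝ) ^ 2 = ∑ a ∈ J, ∑ b ∈ J, c a b := by
    calc _ = ∑ y : ZMod p, ∑ q ∈ J ×ˢ I, ∑ q' ∈ J ×ˢ I,
          (if (q.2 : ZMod p) / q.1 = y then (1 : ℝ) else 0)
            * (if (q'.2 : ZMod p) / q'.1 = y then 1 else 0) := by
          refine Finset.sum_congr rfl fun y _ => ?_
          rw [← Finset.sum_mul_sum, ← sq, Finset.sum_boole]
      _ = ∑ q ∈ J ×ˢ I, ∑ q' ∈ J ×ˢ I,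
          if (q.2 : ZMod p) / q.1 = (q'.2 : ZMod p) / q'.1 then (1 : ℝ) else 0 := by
          rw [Finset.sum_comm]
          refine Finset.sum_congr rfl fun q _ => ?_
          rw [Finset.sum_comm]
          refine Finset.sum_congr rfl fun q' _ => ?_
          simp only [ite_mul, one_mul, zero_mul]
          rw [Finset.sum_ite_eq]
          simp only [Finset.mem_univ, if_true]
          exact if_congr eq_comm rfl rfl
      _ = ∑ a ∈ J, ∑ b ∈ J, ∑ n ∈ I, ∑ m ∈ I,
          if (n : ZMod p) * b = m * a then (1 : ℝ) else 0 := by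
          rw [Finset.sum_product]
          refine Finset.sum_congr rfl fun a ha => ?_
          simp only [Finset.sum_product (s := J) (t := I)]
          rw [Finset.sum_comm]
          refine Finset.sum_congr rfl fun b hb => Finset.sum_congr rfl fun n _ =>
            Finset.sum_congr rfl fun m _ => ?_
          exact if_congr (div_eq_div_iff (hne a ha) (hne b hb)) rfl rfl
      _ = _ := by
          refine Finset.sum_congr rfl fun a _ => Finset.sum_congr rfl fun b _ => ?_
          rw [hc, ← Finset.sum_product', Finset.sum_boole]
  have hsymm : ∀ a b, c a b = c b a := by
    intro a b
    rw [hc]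
    simp only
    congr 1
    refine Finset.card_bij (fun q _ => (q.2, q.1)) ?_ ?_ ?_
    · intro q hq
      simp only [Finset.mem_filter, Finset.mem_product] at hq ⊢
      exact ⟨hq.1.symm, hq.2.symm⟩
    · rintro ⟨n, m⟩ _ ⟨n', m'⟩ _ h
      simpa [and_comm] using h
    · rintro ⟨n, m⟩ hq
      simp only [Finset.mem_filter, Finset.mem_product] at hq
      exact ⟨(m, n), by simp only [Finset.mem_filter, Finset.mem_product]; exact
        ⟨hq.1.symm, hq.2.symm⟩, rfl⟩
  set t : ℕ → ℕ → ℝ := fun a b => if b ≤ a then (a.gcd b : ℝ) / a else 0 with ht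
  have ht0 : ∀ a b, 0 ≤ t a b := by
    intro a b
    simp only [ht]
    split_ifs <;> positivity
  have hbound : ∀ a ∈ J, ∀ b ∈ J, c a b ≤ 1 + N * t a b + N * t b a := by
    intro a ha b hb
    have h1 : ∀ x y, 0 ≤ (N : ℝ) * t x y := fun x y => mul_nonneg (Nat.cast_nonneg _) (ht0 x y)
    rcases le_total b a with h | h
    · have h2 : c a b ≤ 1 + N * (a.gcd b / a) := card_linear_congruence_le hN hAN ha hb
      have h3 : t a b = a.gcd b / a := if_pos h
      rw [h3]
      linarith [h1 b a]
    · have h2 : c b a ≤ 1 + N * (b.gcd a / b) := card_linear_congruence_le hN hAN hb ha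
      have h3 : t b a = b.gcd a / b := if_pos h
      rw [h3, hsymm]
      linarith [h1 a b]
  have htsum : ∑ a ∈ J, ∑ b ∈ J, t a b ≤ A * (1 + Real.log A) := by
    refine le_trans (Finset.sum_le_sum fun a ha => ?_) (sum_card_divisors_le A)
    rw [hJ, Finset.mem_Ioc] at ha
    have ha' : (0 : ℝ) < a := by exact_mod_cast ha.1
    have hf : J.filter (fun b => b ≤ a) = Finset.Ioc 0 a := by
      ext b
      simp only [hJ, Finset.mem_filter, Finset.mem_Ioc]
      omega
    simp only [ht]
    rw [← Finset.sum_filter, hf, ← Finset.sum_div, div_le_iff₀ ha', mul_comm]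
    exact_mod_cast sum_gcd_le a
  have hJc : (J.card : ℝ) = A := by simp [hJ]
  calc _ = ∑ a ∈ J, ∑ b ∈ J, c a b := hsum
    _ ≤ ∑ a ∈ J, ∑ b ∈ J, (1 + N * t a b + N * t b a) :=
        Finset.sum_le_sum fun a ha => Finset.sum_le_sum fun b hb => hbound a ha b hb
    _ = A ^ 2 + 2 * N * ∑ a ∈ J, ∑ b ∈ J, t a b := by
        simp only [Finset.sum_add_distrib, ← Finset.mul_sum]
        rw [Finset.sum_comm (f := fun a b => t b a)]
        simp only [Finset.sum_const, nsmul_eq_mul, hJc]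
        ring
    _ ≤ _ := by gcongr

end Multiplicities

section ShortIntervals

/-- The character sum over `M < n ≤ M + N`. -/
noncomputable def intervalSum {p : ℕ} (χ : MulChar (ZMod p) ℂ) (M N : ℕ) : ℂ :=
  ∑ n ∈ Finset.Ioc M (M + N), χ n

theorem intervalSum_add {p : ℕ} (χ : MulChar (ZMod p) ℂ) (M N K : ℕ) :
    intervalSum χ M (N + K) = intervalSum χ M N + intervalSum χ (M + N) K := by
  rw [intervalSum, intervalSum, intervalSum, add_assoc,
    Finset.sum_Ioc_consecutive (fun n : ℕ => χ (n : ZMod p)) (by omega) (by omega)]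

theorem intervalSum_eq_shift {p : ℕ} (χ : MulChar (ZMod p) ℂ) (M N h : ℕ) :
    intervalSum χ M N = intervalSum χ (M + h) N + (intervalSum χ M h
      - intervalSum χ (M + N) h) := by
  have h1 := intervalSum_add χ M N h
  have h2 := intervalSum_add χ M h N
  rw [add_comm h N] at h2
  linear_combination h2 - h1

theorem intervalSum_add_left {p : ℕ} (χ : MulChar (ZMod p) ℂ) (M N h : ℕ) :
    intervalSum χ (M + h) N = ∑ n ∈ Finset.Ioc M (M + N), χ ((n : ZMod p) + h) := by
  rw [intervalSum, show M + h + N = M + N + h by ring,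
    ← Finset.map_add_right_Ioc, Finset.sum_map]
  simp

theorem norm_intervalSum_le {p : ℕ} [NeZero p] (χ : MulChar (ZMod p) ℂ) (M N : ℕ) :
    ‖intervalSum χ M N‖ ≤ N := by
  rw [intervalSum]
  refine (norm_sum_le_of_le (f := fun n : ℕ => χ (n : ZMod p)) (n := fun _ => (1 : ℝ)) _ fun n _ =>
    DirichletCharacter.norm_le_one χ (n : ZMod p)).trans ?_
  simp

/-- A combination of the inequalities of Hölder and Cauchy–Schwarz. -/
theorem pow_sum_mul_le {ι : Type*} (s : Finset ι) {ν T : ι → ℝ} (hν : ∀ i ∈ s, 0 ≤ ν i)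
    (hT : ∀ i ∈ s, 0 ≤ T i) (h : 0 < ∑ i ∈ s, ν i) {r : ℕ} (hr : 1 ≤ r) :
    (∑ i ∈ s, ν i * T i) ^ (2 * r)
      ≤ (∑ i ∈ s, ν i) ^ (2 * r - 2) * ((∑ i ∈ s, ν i ^ 2) * ∑ i ∈ s, T i ^ (2 * r)) := by
  set V := ∑ i ∈ s, ν i with hV
  have h1 : (∑ i ∈ s, ν i * T i) ^ r ≤ V ^ (r - 1) * ∑ i ∈ s, ν i * T i ^ r := by
    have := Real.pow_arith_mean_le_arith_mean_pow s (fun i => ν i / V) T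
      (fun i hi => div_nonneg (hν i hi) h.le)
      (by rw [← Finset.sum_div, div_self h.ne']) hT r
    have e1 : ∑ i ∈ s, ν i / V * T i = (∑ i ∈ s, ν i * T i) / V := by
      rw [Finset.sum_div]
      exact Finset.sum_congr rfl fun i _ => by ring
    have e2 : ∑ i ∈ s, ν i / V * T i ^ r = (∑ i ∈ s, ν i * T i ^ r) / V := by
      rw [Finset.sum_div]
      exact Finset.sum_congr rfl fun i _ => by ring
    rw [e1, e2, div_pow, div_le_div_iff₀ (pow_pos h r) h] at this
    obtain ⟨k, rfl⟩ : ∃ k, r = k + 1 := ⟨r - 1, by omega⟩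
    rw [Nat.add_sub_cancel]
    refine le_of_mul_le_mul_right ?_ h
    rw [pow_succ V k] at this
    linarith
  have h0 : 0 ≤ ∑ i ∈ s, ν i * T i :=
    Finset.sum_nonneg fun i hi => mul_nonneg (hν i hi) (hT i hi)
  have h2 := Finset.sum_mul_sq_le_sq_mul_sq s ν fun i => T i ^ r
  simp only [← pow_mul, mul_comm r 2] at h2
  calc (∑ i ∈ s, ν i * T i) ^ (2 * r) = ((∑ i ∈ s, ν i * T i) ^ r) ^ 2 := by
        rw [← pow_mul, mul_comm]
    _ ≤ (V ^ (r - 1) * ∑ i ∈ s, ν i * T i ^ r) ^ 2 := by gcongr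
    _ = V ^ (2 * r - 2) * (∑ i ∈ s, ν i * T i ^ r) ^ 2 := by
        rw [mul_pow, ← pow_mul, show (r - 1) * 2 = 2 * r - 2 by omega]
    _ ≤ _ := by gcongr

/-- Averaging over shifts by products, and collecting quotients. -/
theorem norm_sum_intervalSum_le {p : ℕ} [Fact p.Prime] (χ : MulChar (ZMod p) ℂ) {A B M N : ℕ}
    (hA : A < p) :
    ‖∑ a ∈ Finset.Ioc 0 A, ∑ b ∈ Finset.Ioc 0 B, intervalSum χ (M + a * b) N‖
      ≤ ∑ y : ZMod p, (((Finset.Ioc 0 A ×ˢ Finset.Ioc M (M + N)).filter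
          fun q : ℕ × ℕ => (q.2 : ZMod p) / q.1 = y).card : ℝ)
        * ‖∑ b ∈ Finset.Ioc 0 B, χ (y + b)‖ := by
  have hsum : ∑ a ∈ Finset.Ioc 0 A, ∑ b ∈ Finset.Ioc 0 B, intervalSum χ (M + a * b) N
      = ∑ q ∈ Finset.Ioc 0 A ×ˢ Finset.Ioc M (M + N),
        χ q.1 * ∑ b ∈ Finset.Ioc 0 B, χ ((q.2 : ZMod p) / q.1 + b) := by
    rw [Finset.sum_product]
    refine Finset.sum_congr rfl fun a ha => ?_
    have ha0 : (a : ZMod p) ≠ 0 := by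
      intro h
      rw [Finset.mem_Ioc] at ha
      have := Nat.le_of_dvd ha.1 ((ZMod.natCast_eq_zero_iff _ _).mp h)
      omega
    simp only [intervalSum_add_left, Finset.mul_sum]
    rw [Finset.sum_comm]
    refine Finset.sum_congr rfl fun n _ => Finset.sum_congr rfl fun b _ => ?_
    rw [← map_mul]
    congr 1
    push_cast
    field_simp
  rw [hsum]
  calc _ ≤ ∑ q ∈ Finset.Ioc 0 A ×ˢ Finset.Ioc M (M + N),
        ‖∑ b ∈ Finset.Ioc 0 B, χ ((q.2 : ZMod p) / q.1 + b)‖ := by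
        refine norm_sum_le_of_le _ fun q _ => ?_
        rw [norm_mul]
        exact mul_le_of_le_one_left (norm_nonneg _) (DirichletCharacter.norm_le_one χ _)
    _ = _ := by
        rw [← Finset.sum_fiberwise_of_maps_to (t := Finset.univ)
          (g := fun q : ℕ × ℕ => (q.2 : ZMod p) / q.1) fun _ _ => Finset.mem_univ _]
        refine Finset.sum_congr rfl fun y _ => ?_
        rw [← nsmul_eq_mul, ← Finset.sum_const]
        refine Finset.sum_congr rfl fun q hq => ?_
        rw [(Finset.mem_filter.mp hq).2]

theorem injOn_natCast_Ioc {p N : ℕ} (hN : N ≤ p) :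
    Set.InjOn (fun n : ℕ => (n : ZMod p)) (Finset.Ioc 0 N : Finset ℕ) := by
  intro b hb c hc h
  rw [Finset.mem_coe, Finset.mem_Ioc] at hb hc
  refine ((ZMod.natCast_eq_natCast_iff b c p).mp h).eq_of_abs_lt ?_
  rw [abs_lt]
  omega

/-- The high moment bound for sums over `0 < b ≤ B`. -/
theorem sum_norm_sum_Ioc_mulChar_pow_le {p : ℕ} [Fact p.Prime] (hp : p ≠ 2)
    {χ : MulChar (ZMod p) ℂ} (hχ : χ ≠ 1) {B r : ℕ} (hB : B < p) (hr : 1 ≤ r) :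
    ∑ y, ‖∑ b ∈ Finset.Ioc 0 B, χ (y + (b : ZMod p))‖ ^ (2 * r)
      ≤ r ^ (2 * r) * (B : ℝ) ^ r * p + 2 * r * (B : ℝ) ^ (2 * r) * √p := by
  have hinj := injOn_natCast_Ioc hB.le
  have := sum_norm_sum_mulChar_pow_le hp hχ
    ((Finset.Ioc 0 B).image fun b : ℕ => (b : ZMod p)) hr
  rw [Finset.card_image_of_injOn hinj, Nat.card_Ioc, Nat.sub_zero] at this
  simpa only [Finset.sum_image hinj] using this

end ShortIntervals

section Burgess

/-- The right-hand side of the Burgess inequality, without the constant. -/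
noncomputable def burgessBound (r p : ℕ) (x : ℝ) : ℝ :=
  x ^ (1 - 1 / (r : ℝ)) * (p : ℝ) ^ (((r : ℝ) + 1) / (4 * (r : ℝ) ^ 2))
    * Real.log p ^ (1 / (2 * (r : ℝ)))

theorem burgessBound_nonneg (r p : ℕ) {x : ℝ} (hx : 0 ≤ x) : 0 ≤ burgessBound r p x := by
  have := Real.log_natCast_nonneg p
  rw [burgessBound]
  positivity

theorem burgessBound_mono {r p : ℕ} (hr : 1 ≤ r) {x y : ℝ} (hx : 0 ≤ x) (hxy : x ≤ y) :
    burgessBound r p x ≤ burgessBound r p y := by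
  have hr' : (1 : ℝ) ≤ r := by exact_mod_cast hr
  have := Real.log_natCast_nonneg p
  have h1 : (0 : ℝ) ≤ 1 - 1 / r := by
    rw [sub_nonneg]
    exact div_le_one_of_le₀ hr' (by positivity)
  rw [burgessBound, burgessBound]
  gcongr

theorem one_le_log_of_prime {p : ℕ} [Fact p.Prime] (hp : p ≠ 2) : 1 ≤ Real.log p := by
  have hp3 : 3 ≤ p := by
    have := (Fact.out : p.Prime).two_le
    omega
  have h3 : (3 : ℝ) ≤ p := by exact_mod_cast hp3
  rw [Real.le_log_iff_exp_le (by linarith)]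
  linarith [Real.exp_one_lt_d9]

theorem rpow_inv_two_mul_pow {r : ℕ} (hr : 1 ≤ r) {t : ℝ} (ht : 0 ≤ t) :
    (t ^ (1 / (2 * (r : ℝ)))) ^ (2 * r) = t := by
  rw [← Real.rpow_natCast, ← Real.rpow_mul ht]
  have : (r : ℝ) ≠ 0 := by positivity
  push_cast
  rw [one_div_mul_cancel (by positivity), Real.rpow_one]

theorem burgessBound_pow {r : ℕ} (hr : 1 ≤ r) (p : ℕ) {x : ℝ} (hx : 0 ≤ x) :
    burgessBound r p x ^ (2 * r) = x ^ (2 * r - 2)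
      * ((p : ℝ) ^ (1 / (2 * (r : ℝ)))) ^ (r + 1) * Real.log p := by
  have hr0 : (r : ℝ) ≠ 0 := by positivity
  have hp := (Nat.cast_nonneg p : (0 : ℝ) ≤ p)
  rw [burgessBound, mul_pow, mul_pow, rpow_inv_two_mul_pow hr (Real.log_natCast_nonneg p)]
  congr 2
  · rw [← Real.rpow_natCast, ← Real.rpow_mul hx, ← Real.rpow_natCast]
    congr 1
    rw [Nat.cast_sub (by omega)]
    push_cast
    field_simp
  · rw [← Real.rpow_natCast _ (2 * r), ← Real.rpow_mul hp, ← Real.rpow_natCast _ (r + 1),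
      ← Real.rpow_mul hp]
    congr 1
    push_cast
    field_simp
    ring

/-- The averaged sum in Burgess' method. -/
theorem norm_sum_intervalSum_le_burgessBound {p : ℕ} [Fact p.Prime] (hp : p ≠ 2)
    {χ : MulChar (ZMod p) ℂ} (hχ : χ ≠ 1) {r A B M N : ℕ} (hr : 2 ≤ r) (hA : 1 ≤ A) (hB : 1 ≤ B)
    (hBP : (B : ℝ) ≤ (p : ℝ) ^ (1 / (2 * (r : ℝ))))
    (hPB : (p : ℝ) ^ (1 / (2 * (r : ℝ))) ≤ 2 * B) (hAB : 16 * (A * B) ≤ N)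
    (hN : N ≤ 32 * (A * B)) (hNp : (N : ℝ) ^ 2 ≤ p * (p : ℝ) ^ (1 / (2 * (r : ℝ)))) :
    ‖∑ a ∈ Finset.Ioc 0 A, ∑ b ∈ Finset.Ioc 0 B, intervalSum χ (M + a * b) N‖
      ≤ 160 * ((r : ℝ) ^ (2 * r) + 2 * r) * 2 ^ r * (A * B) * burgessBound r p N := by
  set P := (p : ℝ) ^ (1 / (2 * (r : ℝ))) with hP
  set D := (r : ℝ) ^ (2 * r) + 2 * r with hD
  set L := Real.log p with hL
  have hL1 : 1 ≤ L := one_le_log_of_prime hp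
  have hp0 : (0 : ℝ) ≤ p := Nat.cast_nonneg p
  have hPp : P ^ (2 * r) = p := rpow_inv_two_mul_pow (by omega) hp0
  have hA' : (1 : ℝ) ≤ A := by exact_mod_cast hA
  have hB' : (1 : ℝ) ≤ B := by exact_mod_cast hB
  have hP1 : 1 ≤ P := hB'.trans hBP
  have hr' : (2 : ℝ) ≤ r := by exact_mod_cast hr
  have hAB' : (16 : ℝ) * (A * B) ≤ N := by exact_mod_cast hAB
  have hN' : (N : ℝ) ≤ 32 * (A * B) := by exact_mod_cast hN
  have hN1 : 1 ≤ N := by nlinarith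
  have hD1 : 1 ≤ D := by
    have : 0 ≤ (r : ℝ) ^ (2 * r) := by positivity
    linarith
  have hAN : 2 * A * N ≤ p := by
    have h1 : (2 * A * N : ℝ) * (4 * P) ≤ p * (4 * P) := by
      calc (2 * A * N : ℝ) * (4 * P) ≤ 2 * A * N * (4 * (2 * B)) := by gcongr
        _ = (16 * (A * B)) * N := by ring
        _ ≤ N * N := by gcongr
        _ = N ^ 2 := by ring
        _ ≤ p * P := hNp
        _ ≤ p * (4 * P) := by gcongr; linarith
    exact_mod_cast le_of_mul_le_mul_right h1 (by positivity)
  have hAp : A < p := by nlinarith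
  have hsqrt : P ^ r = √p := by
    rw [← hPp, mul_comm 2 r, pow_mul, Real.sqrt_sq (by positivity)]
  have hBp : B < p := by
    have h1 : P ^ 2 ≤ P ^ (2 * r) := pow_le_pow_right₀ hP1 (by omega)
    rw [hPp] at h1
    have h2 : (3 : ℝ) ≤ p := by
      have h3 := (Fact.out : p.Prime).two_le
      have : 3 ≤ p := by omega
      exact_mod_cast this
    have : (B : ℝ) < p := by nlinarith
    exact_mod_cast this
  set ν : ZMod p → ℝ := fun y => ((Finset.Ioc 0 A ×ˢ Finset.Ioc M (M + N)).filter
    fun q : ℕ × ℕ => (q.2 : ZMod p) / q.1 = y).card with hν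
  set T : ZMod p → ℝ := fun y => ‖∑ b ∈ Finset.Ioc 0 B, χ (y + (b : ZMod p))‖ with hT
  have hνsum : ∑ y, ν y = A * N := by
    have := Finset.card_eq_sum_card_fiberwise (s := Finset.Ioc 0 A ×ˢ Finset.Ioc M (M + N))
      (t := Finset.univ) (f := fun q : ℕ × ℕ => (q.2 : ZMod p) / q.1)
      fun _ _ => Finset.mem_coe.mpr (Finset.mem_univ _)
    rw [Finset.card_product, Nat.card_Ioc, Nat.card_Ioc, Nat.sub_zero, Nat.add_sub_cancel_left]
      at this
    simp only [hν]
    exact_mod_cast this.symm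
  have hνsq : ∑ y, ν y ^ 2 ≤ 5 * (A * N * L) := by
    refine (sum_card_div_eq_sq_le hN1 hAN).trans ?_
    have h1 : (A : ℝ) ≤ N := by nlinarith
    have h2 : Real.log A ≤ L := Real.log_le_log (by linarith) (by exact_mod_cast hAp.le)
    have h3 : (A : ℝ) ^ 2 ≤ A * N * L := by
      calc (A : ℝ) ^ 2 = A * A * 1 := by ring
        _ ≤ A * N * L := by gcongr
    have h4 : 2 * N * (A * (1 + Real.log A)) ≤ 2 * N * (A * (L + L)) := by gcongr
    linarith
  have hTsum : ∑ y, T y ^ (2 * r) ≤ D * (B ^ r * p) := by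
    refine (sum_norm_sum_Ioc_mulChar_pow_le hp hχ hBp (by omega)).trans ?_
    have h1 : (B : ℝ) ^ (2 * r) * √p ≤ B ^ r * p := by
      calc (B : ℝ) ^ (2 * r) * √p = B ^ r * B ^ r * √p := by ring
        _ ≤ B ^ r * P ^ r * √p := by gcongr
        _ = B ^ r * (√p * √p) := by rw [hsqrt]; ring
        _ = B ^ r * p := by rw [Real.mul_self_sqrt hp0]
    have h2 : 2 * r * (B : ℝ) ^ (2 * r) * √p ≤ 2 * r * (B ^ r * p) := by
      rw [mul_assoc]
      gcongr
    rw [hD]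
    linarith
  refine (norm_sum_intervalSum_le χ hAp).trans ?_
  change ∑ y, ν y * T y ≤ _
  have hAN0 : (0 : ℝ) < A * N := by positivity
  have hmain := pow_sum_mul_le Finset.univ (ν := ν) (T := T) (fun _ _ => Nat.cast_nonneg _)
    (fun _ _ => norm_nonneg _) (hνsum ▸ hAN0) (r := r) (by omega)
  rw [hνsum] at hmain
  set K := 160 * D * 2 ^ r with hK
  have hK1 : 1 ≤ K := by
    have : (1 : ℝ) ≤ 2 ^ r := one_le_pow₀ (by norm_num)
    nlinarith
  refine le_of_pow_le_pow_left₀ (n := 2 * r) (by omega)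
    (mul_nonneg (by positivity) (burgessBound_nonneg r p (Nat.cast_nonneg N))) ?_
  rw [mul_pow, burgessBound_pow (by omega) p (Nat.cast_nonneg N)]
  refine hmain.trans ?_
  have hTnn : 0 ≤ ∑ y, T y ^ (2 * r) := Finset.sum_nonneg fun _ _ => by positivity
  calc ((A : ℝ) * N) ^ (2 * r - 2) * ((∑ y, ν y ^ 2) * ∑ y, T y ^ (2 * r))
      ≤ ((A : ℝ) * N) ^ (2 * r - 2) * ((5 * (A * N * L)) * (D * (B ^ r * p))) := by gcongr
    _ ≤ K * (A * B) ^ (2 * r) * (N ^ (2 * r - 2) * P ^ (r + 1) * L) := by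
        rw [← hPp]
        obtain ⟨k, rfl⟩ : ∃ k, r = k + 1 := ⟨r - 1, by omega⟩
        rw [show 2 * (k + 1) - 2 = 2 * k by omega]
        have h1 : 5 * D * N * P ^ k ≤ K * A * B ^ (k + 1) := by
          calc 5 * D * N * P ^ k ≤ 5 * D * (32 * (A * B)) * (2 * B) ^ k := by gcongr
            _ = 160 * D * 2 ^ k * A * B ^ (k + 1) := by ring
            _ ≤ K * A * B ^ (k + 1) := by
              rw [hK]
              gcongr
              · norm_num
              · omega
        calc ((A : ℝ) * N) ^ (2 * k) * (5 * (A * N * L) * (D * (B ^ (k + 1) * P ^ (2 * (k + 1)))))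
            = (5 * D * N * P ^ k) *
              (A ^ (2 * k + 1) * N ^ (2 * k) * B ^ (k + 1) * P ^ (k + 2) * L) := by ring
          _ ≤ (K * A * B ^ (k + 1)) *
              (A ^ (2 * k + 1) * N ^ (2 * k) * B ^ (k + 1) * P ^ (k + 2) * L) := by gcongr
          _ = _ := by ring
    _ ≤ (K * (A * B)) ^ (2 * r) * (N ^ (2 * r - 2) * P ^ (r + 1) * L) := by
        rw [mul_pow K]
        gcongr
        exact le_self_pow₀ hK1 (by omega)

end Burgess

section ShortBound

/-- Burgess' inequality for intervals of length at most `p ^ (1 / 2 + 1 / (4 * r))`. -/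
theorem norm_intervalSum_le_of_sq_le {p : ℕ} [Fact p.Prime] (hp : p ≠ 2)
    {χ : MulChar (ZMod p) ℂ} (hχ : χ ≠ 1) {r : ℕ} (hr : 2 ≤ r) (N M : ℕ)
    (hN : (N : ℝ) ^ 2 ≤ p * (p : ℝ) ^ (1 / (2 * (r : ℝ)))) :
    ‖intervalSum χ M N‖
      ≤ (16 + 2 * (160 * ((r : ℝ) ^ (2 * r) + 2 * r) * 2 ^ r)) * burgessBound r p N := by
  induction N using Nat.strong_induction_on generalizing M with
  | _ N ih =>
  set P := (p : ℝ) ^ (1 / (2 * (r : ℝ))) with hP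
  set K := 160 * ((r : ℝ) ^ (2 * r) + 2 * r) * 2 ^ r with hK
  have hK0 : 0 ≤ K := by positivity
  have hp1 : (1 : ℝ) ≤ p := by exact_mod_cast (Fact.out : p.Prime).one_le
  have hP1 : 1 ≤ P := Real.one_le_rpow hp1 (by positivity)
  set B := ⌊P⌋₊ with hB
  have hB1 : 1 ≤ B := Nat.le_floor (by exact_mod_cast hP1)
  have hBP : (B : ℝ) ≤ P := Nat.floor_le (by linarith)
  have hB1' : (1 : ℝ) ≤ B := by exact_mod_cast hB1
  have hPB : P ≤ 2 * B := by linarith [Nat.lt_floor_add_one P]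
  set A := N / (16 * B) with hA
  have hAB : 16 * (A * B) ≤ N := by
    have := Nat.div_mul_le_self N (16 * B)
    rw [← hA] at this
    linarith
  have hNA : N < 16 * (A * B) + 16 * B := by
    have := Nat.lt_div_mul_add (a := N) (b := 16 * B) (by omega)
    rw [← hA] at this
    linarith
  have hbb := burgessBound_nonneg r p (Nat.cast_nonneg N : (0 : ℝ) ≤ N)
  rcases Nat.eq_zero_or_pos A with hA0 | hA1
  · have hNP : (N : ℝ) ≤ 16 * P := by
      rw [hA0] at hNA
      have : (N : ℝ) ≤ 16 * B := by exact_mod_cast (by omega : N ≤ 16 * B)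
      linarith
    have h16 : (N : ℝ) ≤ 16 * burgessBound r p N := by
      refine le_of_pow_le_pow_left₀ (n := 2 * r) (by omega) (by positivity) ?_
      rw [mul_pow, burgessBound_pow (by omega) p (Nat.cast_nonneg N), ← hP]
      have hlog := one_le_log_of_prime hp
      calc (N : ℝ) ^ (2 * r) = N ^ (2 * r - 2) * N ^ 2 * 1 := by
            rw [← pow_add, mul_one]
            congr 1
            omega
        _ ≤ N ^ (2 * r - 2) * (16 * P) ^ 2 * Real.log p := by gcongr
        _ = 16 ^ 2 * (N ^ (2 * r - 2) * P ^ 2 * Real.log p) := by ring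
        _ ≤ 16 ^ (2 * r) * (N ^ (2 * r - 2) * P ^ (r + 1) * Real.log p) := by
            gcongr
            · norm_num
            · omega
            · omega
    refine (norm_intervalSum_le χ M N).trans (h16.trans ?_)
    gcongr
    linarith
  have hAB1 : 1 ≤ A * B := Nat.mul_pos hA1 hB1
  have hABN : (16 : ℝ) * (A * B) ≤ N := by exact_mod_cast hAB
  have hAB1' : (1 : ℝ) ≤ A * B := by exact_mod_cast hAB1
  have hquarter : burgessBound r p ((N : ℝ) / 16) ≤ burgessBound r p N / 4 := by
    refine le_of_pow_le_pow_left₀ (n := 2 * r) (by omega) (by positivity) ?_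
    rw [div_pow, burgessBound_pow (by omega) p (Nat.cast_nonneg N),
      burgessBound_pow (by omega) p (by positivity), div_pow, div_mul_eq_mul_div,
      div_mul_eq_mul_div]
    have hlog := Real.log_natCast_nonneg p
    gcongr
    rw [show (16 : ℝ) = 4 ^ 2 by norm_num, ← pow_mul]
    gcongr
    · norm_num
    · omega
  have herr : ∀ a ∈ Finset.Ioc 0 A, ∀ b ∈ Finset.Ioc 0 B, ∀ M',
      ‖intervalSum χ M' (a * b)‖ ≤ (16 + 2 * K) * (burgessBound r p N / 4) := by
    intro a ha b hb M'
    rw [Finset.mem_Ioc] at ha hb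
    have hab : a * b ≤ A * B := Nat.mul_le_mul ha.2 hb.2
    have hab' : ((a * b : ℕ) : ℝ) ≤ N / 16 := by
      have : ((a * b : ℕ) : ℝ) ≤ A * B := by exact_mod_cast hab
      linarith
    have hlt : a * b < N := by omega
    refine (ih (a * b) hlt M' (le_trans ?_ hN)).trans ?_
    · gcongr
    · gcongr
      exact (burgessBound_mono (by omega) (Nat.cast_nonneg _) hab').trans hquarter
  have hid : ((A * B : ℕ) : ℂ) * intervalSum χ M N
      = (∑ a ∈ Finset.Ioc 0 A, ∑ b ∈ Finset.Ioc 0 B, intervalSum χ (M + a * b) N)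
        + ∑ a ∈ Finset.Ioc 0 A, ∑ b ∈ Finset.Ioc 0 B,
          (intervalSum χ M (a * b) - intervalSum χ (M + N) (a * b)) := by
    simp only [← Finset.sum_add_distrib, ← intervalSum_eq_shift]
    simp [mul_assoc]
  have hmain := norm_sum_intervalSum_le_burgessBound hp hχ (M := M) hr hA1 hB1 hBP hPB hAB
    (by nlinarith) hN
  have herrsum : ‖∑ a ∈ Finset.Ioc 0 A, ∑ b ∈ Finset.Ioc 0 B,
      (intervalSum χ M (a * b) - intervalSum χ (M + N) (a * b))‖
      ≤ A * B * ((16 + 2 * K) * (burgessBound r p N / 2)) := by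
    refine (norm_sum_le_of_le _ fun a ha => norm_sum_le_of_le _ fun b hb =>
      (norm_sub_le _ _).trans (add_le_add (herr a ha b hb M) (herr a ha b hb (M + N)))).trans ?_
    simp only [Finset.sum_const, Nat.card_Ioc, Nat.sub_zero, nsmul_eq_mul]
    apply le_of_eq
    ring
  rw [← hK] at hmain
  refine le_of_mul_le_mul_left (a := (A * B : ℝ)) ?_ (by linarith)
  calc (A * B : ℝ) * ‖intervalSum χ M N‖ = ‖((A * B : ℕ) : ℂ) * intervalSum χ M N‖ := by
        rw [norm_mul, Complex.norm_natCast]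
        push_cast
        rfl
    _ ≤ K * (A * B) * burgessBound r p N
        + A * B * ((16 + 2 * K) * (burgessBound r p N / 2)) := by
        rw [hid]
        exact (norm_add_le _ _).trans (add_le_add hmain herrsum)
    _ ≤ A * B * ((16 + 2 * K) * burgessBound r p N) := by
        have : 0 ≤ (A * B : ℝ) * burgessBound r p N := by positivity
        nlinarith

end ShortBound

section LongBound

theorem sum_mulChar_mul_inv_shift {F : Type*} [Field F] [Fintype F] {χ : MulChar F ℂ}
    (hχ : χ ≠ 1) {b c : F} (hbc : b ≠ c) : ∑ y, χ (y + b) * χ⁻¹ (y + c) = -1 := by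
  have h : b - c ≠ 0 := sub_ne_zero.mpr hbc
  have hsum : ∑ y, χ (y + b) * χ⁻¹ (y + c) = ∑ t, χ ((b - c) * t) * χ⁻¹ ((b - c) * (t - 1)) := by
    refine Fintype.sum_equiv ((Equiv.addRight b).trans (Equiv.mulLeft₀ (b - c) h).symm) _ _
      fun y => ?_
    simp only [Equiv.trans_apply, Equiv.coe_addRight, Equiv.mulLeft₀_symm_apply]
    congr 2
    · field_simp
    · field_simp
      ring
  have hterm : ∀ t : F, χ ((b - c) * t) * χ⁻¹ ((b - c) * (t - 1))
      = χ⁻¹ (-1) * (χ t * χ⁻¹ (1 - t)) := by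
    intro t
    rw [show (b - c) * (t - 1) = (b - c) * (-1 * (1 - t)) by ring, map_mul, map_mul, map_mul]
    have h1 : χ (b - c) * χ⁻¹ (b - c) = 1 := by
      rw [← MulChar.mul_apply, mul_inv_cancel, MulChar.one_apply h.isUnit]
    linear_combination χ t * χ⁻¹ (-1) * χ⁻¹ (1 - t) * h1
  have h1 : χ⁻¹ (-1) * χ (-1) = 1 := by
    rw [← MulChar.mul_apply, inv_mul_cancel, MulChar.one_apply isUnit_one.neg]
  simp only [hsum, hterm, ← Finset.mul_sum]
  have hJ := jacobiSum_nontrivial_inv hχ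
  rw [jacobiSum] at hJ
  rw [hJ]
  linear_combination -h1

/-- The second moment of sums over the translates of a set. -/
theorem sum_norm_sum_mulChar_sq_le {F : Type*} [Field F] [Fintype F] {χ : MulChar F ℂ}
    (hχ : χ ≠ 1) (s : Finset F) :
    ∑ y, ‖∑ b ∈ s, χ (y + b)‖ ^ 2 ≤ s.card * Fintype.card F := by
  classical
  have hexp : ((∑ y, ‖∑ b ∈ s, χ (y + b)‖ ^ 2 : ℝ) : ℂ)
      = ∑ b ∈ s, ∑ c ∈ s, ∑ y, χ (y + b) * χ⁻¹ (y + c) := by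
    push_cast
    simp only [← Complex.mul_conj', map_sum, Finset.sum_mul_sum]
    rw [Finset.sum_comm]
    refine Finset.sum_congr rfl fun b _ => ?_
    rw [Finset.sum_comm]
    refine Finset.sum_congr rfl fun c _ => Finset.sum_congr rfl fun y _ => ?_
    rw [← MulChar.star_apply' χ]
    rfl
  have hterm : ∀ b c : F, (∑ y, χ (y + b) * χ⁻¹ (y + c)).re
      ≤ if b = c then (Fintype.card F : ℝ) else 0 := by
    intro b c
    split_ifs with h
    · subst h
      refine (Complex.re_le_norm _).trans
        ((norm_sum_le_of_le (n := fun _ => (1 : ℝ)) _ fun y _ => ?_).trans (by simp))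
      rw [← MulChar.mul_apply, mul_inv_cancel]
      by_cases hy : IsUnit (y + b)
      · rw [MulChar.one_apply hy, norm_one]
      · rw [MulChar.map_nonunit _ hy, norm_zero]
        exact zero_le_one
    · rw [sum_mulChar_mul_inv_shift hχ h]
      norm_num
  rw [← Complex.ofReal_re (∑ y, ‖∑ b ∈ s, χ (y + b)‖ ^ 2), hexp]
  simp only [Complex.re_sum] at hterm ⊢
  refine (Finset.sum_le_sum fun b _ => Finset.sum_le_sum fun c _ => hterm b c).trans ?_
  simp

/-- The average over translations of a long sum. -/
theorem norm_sum_intervalSum_sq_le {p : ℕ} [Fact p.Prime] {χ : MulChar (ZMod p) ℂ} (hχ : χ ≠ 1)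
    {H N : ℕ} (hH : H ≤ p) (hN : N ≤ p) :
    ‖∑ h ∈ Finset.Ioc 0 H, intervalSum χ (0 + h) N‖ ^ 2 ≤ N * (H * p) := by
  set T : ZMod p → ℝ := fun y => ‖∑ h ∈ Finset.Ioc 0 H, χ (y + (h : ZMod p))‖ with hT
  have hT2 : ∑ y, T y ^ 2 ≤ H * p := by
    have := sum_norm_sum_mulChar_sq_le hχ ((Finset.Ioc 0 H).image fun b : ℕ => (b : ZMod p))
    rw [Finset.card_image_of_injOn (injOn_natCast_Ioc hH), Nat.card_Ioc, Nat.sub_zero,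
      ZMod.card] at this
    simpa only [Finset.sum_image (injOn_natCast_Ioc hH)] using this
  have h1 : ‖∑ h ∈ Finset.Ioc 0 H, intervalSum χ (0 + h) N‖
      ≤ ∑ n ∈ Finset.Ioc 0 N, 1 * T n := by
    simp only [intervalSum_add_left]
    simp only [one_mul, zero_add]
    rw [Finset.sum_comm]
    exact norm_sum_le _ _
  calc ‖∑ h ∈ Finset.Ioc 0 H, intervalSum χ (0 + h) N‖ ^ 2
      ≤ (∑ n ∈ Finset.Ioc 0 N, 1 * T n) ^ 2 := by gcongr
    _ ≤ (∑ n ∈ Finset.Ioc 0 N, (1 : ℝ) ^ 2) * ∑ n ∈ Finset.Ioc 0 N, T n ^ 2 :=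
        Finset.sum_mul_sq_le_sq_mul_sq _ _ _
    _ ≤ N * (H * p) := by
        have h2 : ∑ n ∈ Finset.Ioc 0 N, T n ^ 2 ≤ ∑ y, T y ^ 2 := by
          rw [← Finset.sum_image (f := fun y : ZMod p => T y ^ 2) (injOn_natCast_Ioc hN)]
          exact Finset.sum_le_sum_of_subset_of_nonneg (Finset.subset_univ _)
            fun _ _ _ => by positivity
        simp only [one_pow, Finset.sum_const, Nat.card_Ioc, Nat.sub_zero, nsmul_eq_mul, mul_one]
        gcongr
        exact h2.trans hT2

theorem norm_intervalSum_zero_le {p : ℕ} [Fact p.Prime] (hp : p ≠ 2)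
    {χ : MulChar (ZMod p) ℂ} (hχ : χ ≠ 1) {r : ℕ} (hr : 2 ≤ r) {C : ℝ} (hC : 0 ≤ C)
    (hshort : ∀ N M : ℕ, (N : ℝ) ^ 2 ≤ p * (p : ℝ) ^ (1 / (2 * (r : ℝ))) →
      ‖intervalSum χ M N‖ ≤ C * burgessBound r p N) {N : ℕ} (hN : N < p) :
    ‖intervalSum χ 0 N‖ ≤ (2 + 2 * C) * burgessBound r p N := by
  set P := (p : ℝ) ^ (1 / (2 * (r : ℝ))) with hP
  have hbb := burgessBound_nonneg r p (Nat.cast_nonneg N : (0 : ℝ) ≤ N)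
  rcases le_or_gt ((N : ℝ) ^ 2) (p * P) with h | hlong
  · refine (hshort N 0 h).trans ?_
    gcongr
    linarith
  have hp1 : (1 : ℝ) ≤ p := by exact_mod_cast (Fact.out : p.Prime).one_le
  have hP1 : 1 ≤ P := Real.one_le_rpow hp1 (by positivity)
  have hPp : P ^ (2 * r) = p := rpow_inv_two_mul_pow (by omega) (by linarith)
  have hlog := one_le_log_of_prime hp
  set Q := √(p * P) with hQ
  have hQ2 : Q ^ 2 = p * P := Real.sq_sqrt (by positivity)
  have hQ1 : 1 ≤ Q := Real.one_le_sqrt.mpr (one_le_mul_of_one_le_of_one_le hp1 hP1)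
  have hQN : Q ≤ N := (Real.sqrt_le_left (Nat.cast_nonneg N)).mpr hlong.le
  set H := ⌊Q⌋₊ with hH
  have hHQ : (H : ℝ) ≤ Q := Nat.floor_le (by linarith)
  have hH1 : (1 : ℝ) ≤ H := by exact_mod_cast (Nat.le_floor (by exact_mod_cast hQ1) : 1 ≤ H)
  have hQH : Q ≤ 2 * H := by linarith [Nat.lt_floor_add_one Q]
  have hHN : H ≤ N := by exact_mod_cast hHQ.trans hQN
  have hN0 : (0 : ℝ) ≤ N := Nat.cast_nonneg N
  have hmain : ‖∑ h ∈ Finset.Ioc 0 H, intervalSum χ (0 + h) N‖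
      ≤ 2 * H * burgessBound r p N := by
    have h2 := norm_sum_intervalSum_sq_le hχ (hHN.trans hN.le) hN.le
    refine le_of_pow_le_pow_left₀ (n := 2 * r) (by omega) (by positivity) ?_
    rw [mul_pow, burgessBound_pow (by omega) p hN0, ← hP, pow_mul]
    refine (pow_le_pow_left₀ (by positivity) h2 r).trans ?_
    obtain ⟨k, rfl⟩ : ∃ k, r = k + 2 := ⟨r - 2, by omega⟩
    rw [show 2 * (k + 2) - 2 = 2 * k + 2 by omega]
    have hQP : Q ^ 2 = P ^ (2 * k + 5) := by
      rw [hQ2, ← hPp]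
      ring
    calc ((N : ℝ) * (H * p)) ^ (k + 2)
        = N ^ (k + 2) * H ^ (k + 2) * ((P ^ (2 * k + 5)) ^ (k + 1) * P ^ (k + 3)) := by
          rw [← hPp]
          ring
      _ = N ^ (k + 2) * H ^ (k + 2) * (Q ^ k * Q ^ (k + 2) * P ^ (k + 3)) * 1 := by
          rw [← hQP]
          ring
      _ ≤ N ^ (k + 2) * H ^ (k + 2) * (N ^ k * (2 * H) ^ (k + 2) * P ^ (k + 3))
          * Real.log p := by gcongr
      _ = 2 ^ (k + 2) * (H ^ (2 * (k + 2)) * (N ^ (2 * k + 2) * P ^ (k + 3) * Real.log p)) := by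
          ring
      _ ≤ 2 ^ (2 * (k + 2)) * (H ^ (2 * (k + 2)) * (N ^ (2 * k + 2) * P ^ (k + 3)
          * Real.log p)) := by
          gcongr
          · norm_num
          · omega
      _ = _ := by ring
  have herr : ∀ h ∈ Finset.Ioc 0 H, ∀ M, ‖intervalSum χ M h‖ ≤ C * burgessBound r p N := by
    intro h hh M
    have hhH : h ≤ H := (Finset.mem_Ioc.mp hh).2
    refine (hshort h M ?_).trans ?_
    · rw [← hQ2]
      have : (h : ℝ) ≤ Q := le_trans (by exact_mod_cast hhH) hHQ
      gcongr
    · gcongr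
      exact burgessBound_mono (by omega) (Nat.cast_nonneg h) (by exact_mod_cast hhH.trans hHN)
  have herrsum : ‖∑ h ∈ Finset.Ioc 0 H, (intervalSum χ 0 h - intervalSum χ (0 + N) h)‖
      ≤ H * (2 * C * burgessBound r p N) := by
    refine (norm_sum_le_of_le _ fun h hh => (norm_sub_le _ _).trans
      (add_le_add (herr h hh 0) (herr h hh (0 + N)))).trans ?_
    simp only [Finset.sum_const, Nat.card_Ioc, Nat.sub_zero, nsmul_eq_mul]
    apply le_of_eq
    ring
  have hid : (H : ℂ) * intervalSum χ 0 N = (∑ h ∈ Finset.Ioc 0 H, intervalSum χ (0 + h) N)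
      + ∑ h ∈ Finset.Ioc 0 H, (intervalSum χ 0 h - intervalSum χ (0 + N) h) := by
    simp only [← Finset.sum_add_distrib, ← intervalSum_eq_shift]
    simp
  refine le_of_mul_le_mul_left (a := (H : ℝ)) ?_ (by linarith)
  calc (H : ℝ) * ‖intervalSum χ 0 N‖ = ‖(H : ℂ) * intervalSum χ 0 N‖ := by
        rw [norm_mul, Complex.norm_natCast]
    _ ≤ 2 * H * burgessBound r p N + H * (2 * C * burgessBound r p N) := by
        rw [hid]
        exact (norm_add_le _ _).trans (add_le_add hmain herrsum)
    _ = H * ((2 + 2 * C) * burgessBound r p N) := by ring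

theorem intervalSum_zero_self {p : ℕ} [Fact p.Prime] {χ : MulChar (ZMod p) ℂ} (hχ : χ ≠ 1) :
    intervalSum χ 0 p = 0 := by
  have himg : (Finset.Ioc 0 p).image (fun n : ℕ => (n : ZMod p)) = Finset.univ := by
    rw [← Finset.card_eq_iff_eq_univ, Finset.card_image_of_injOn (injOn_natCast_Ioc le_rfl),
      Nat.card_Ioc, ZMod.card, Nat.sub_zero]
  rw [intervalSum, zero_add,
    ← Finset.sum_image (f := fun y : ZMod p => χ y) (injOn_natCast_Ioc le_rfl), himg]
  exact MulChar.sum_eq_zero_of_ne_one hχ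

theorem intervalSum_zero_mod {p : ℕ} [Fact p.Prime] {χ : MulChar (ZMod p) ℂ} (hχ : χ ≠ 1)
    (N : ℕ) : intervalSum χ 0 (N % p) = intervalSum χ 0 N := by
  induction N using Nat.strong_induction_on with
  | _ N ih =>
  rcases lt_or_ge N p with h | h
  · rw [Nat.mod_eq_of_lt h]
  · have hp := (Fact.out : p.Prime).pos
    rw [Nat.mod_eq_sub_mod h, ih (N - p) (by omega)]
    conv_rhs => rw [← Nat.add_sub_cancel' h, intervalSum_add, intervalSum_zero_self hχ, zero_add,
      intervalSum_add_left]
    simp [intervalSum]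

end LongBound

/-- The Burgess inequality: for every integer `r ≥ 2` and every nonprincipal Dirichlet
character `χ` mod a prime `p`,
`|∑_{m ≤ x} χ(m)| ≤ C(r) x^(1-1/r) p^((r+1)/(4r²)) (log p)^(1/(2r))`. -/
theorem burgess_inequality :
    ∀ r : ℕ, 2 ≤ r → ∃ C : ℝ, 0 < C ∧ ∀ (p : ℕ) [Fact p.Prime],
      ∀ χ : DirichletCharacter ℂ p, χ ≠ 1 →
      ∀ x : ℝ, 2 ≤ x →
        ‖∑ m ∈ Finset.Icc 1 ⌊x⌋₊, χ (m : ZMod p)‖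
          ≤ C * x ^ (1 - 1 / (r : ℝ)) * (p : ℝ) ^ (((r : ℝ) + 1) / (4 * (r : ℝ) ^ 2))
            * (Real.log p) ^ (1 / (2 * (r : ℝ))) := by
  intro r hr
  set C := 16 + 2 * (160 * ((r : ℝ) ^ (2 * r) + 2 * r) * 2 ^ r) with hC
  have hC0 : 0 ≤ C := by positivity
  refine ⟨2 + 2 * C, by positivity, fun p _ χ hχ x hx => ?_⟩
  have hp : p ≠ 2 := by
    rintro rfl
    refine hχ (MulChar.ext fun a => ?_)
    rw [Subsingleton.elim a 1, Units.val_one, map_one, map_one]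
  have hsum : ∑ m ∈ Finset.Icc 1 ⌊x⌋₊, χ (m : ZMod p) = intervalSum χ 0 (⌊x⌋₊ % p) := by
    rw [intervalSum_zero_mod hχ, intervalSum, zero_add]
    rfl
  have hle : ((⌊x⌋₊ % p : ℕ) : ℝ) ≤ x :=
    (Nat.cast_le.mpr (Nat.mod_le _ _)).trans (Nat.floor_le (by linarith))
  rw [hsum]
  calc ‖intervalSum χ 0 (⌊x⌋₊ % p)‖ ≤ (2 + 2 * C) * burgessBound r p (⌊x⌋₊ % p : ℕ) :=
        norm_intervalSum_zero_le hp hχ hr hC0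
          (fun N M hN => norm_intervalSum_le_of_sq_le hp hχ hr N M hN)
          (Nat.mod_lt _ (Fact.out : p.Prime).pos)
    _ ≤ (2 + 2 * C) * burgessBound r p x := by
        gcongr
        exact burgessBound_mono (by omega) (Nat.cast_nonneg _) hle
    _ = _ := by
        rw [burgessBound]
        ring
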